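/- arXiv:2302.12230 — 2 statements merged into one kernel-verified Lean document; each statement's English description precedes it below -/
import Mathlib

section
/- Let a and d be positive integers with 0 ≤ a ≤ d, let G be a bipartite d-regular graph on n vertices, and let 1 ≤ K, m ≤ n. Let S be a finite set containing V(G), and let U ⊆ ℝ^S be a subspace of dimension at most m spanned by pairwise orthogonal unit vectors u_1, …, u_{m'} satisfying ‖u_i‖_∞ ≤ √(K/n) for each 1 ≤ i ≤ m'. If m ≥ max(2·log₂ d, 15) and n ≥ K³·m⁶, then there exists an a-regular spanning subgraph H of G such that |vᵀ(A_H − (a/d)·A_G)v| ≤ 7√d for every unit vector v ∈ U, where A_H and A_G are extended by zeros to matrices indexed by S × S. -/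
open Matrix

/-- The adjacency matrix of a finite simple graph, with real entries. -/
noncomputable def adjMat {V : Type*} [Fintype V] (G : SimpleGraph V) : Matrix V V ℝ :=
  letI := Classical.decRel G.Adj
  G.adjMatrix ℝ

noncomputable def deg {V : Type*} [Fintype V] (G : SimpleGraph V) (v : V) : ℕ :=
  letI := Classical.decRel G.Adj
  G.degree v

/-- `G` is `d`-regular. -/
def IsRegularGraph {V : Type*} [Fintype V] (G : SimpleGraph V) (d : ℕ) : Prop :=
  ∀ v, deg G v = d

/-- `G` is bipartite. -/
def Bipartite {V : Type*} (G : SimpleGraph V) : Prop := G.Colorable 2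

/-- Extension of a matrix indexed by `V` to a matrix indexed by `S ⊇ V` (via an embedding
`f : V ↪ S`), filling the new entries with zeros. -/
def extendMat {V S : Type*} [Fintype V] [DecidableEq S] (f : V ↪ S) (A : Matrix V V ℝ) :
    Matrix S S ℝ :=
  Matrix.of fun s t => ∑ v : V, ∑ w : V, if f v = s ∧ f w = t then A v w else 0


noncomputable def frc {E : Type*} [Fintype E] (x : E → ℝ) : Finset E :=
  Finset.univ.filter (fun e => 0 < x e ∧ x e < 1)

theorem mem_frc {E : Type*} [Fintype E] (x : E → ℝ) (e : E) :
    e ∈ frc x ↔ 0 < x e ∧ x e < 1 := by simp [frc]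

theorem move_lem {E : Type*} [Fintype E] (x z : E → ℝ) (hx : ∀ e, 0 ≤ x e ∧ x e ≤ 1)
    (hz : ∀ e, e ∉ frc x → z e = 0) (hz0 : z ≠ 0) :
    ∃ t : ℝ, (∀ e, 0 ≤ x e + t * z e ∧ x e + t * z e ≤ 1) ∧
      frc (fun e => x e + t * z e) ⊂ frc x := by
  classical
  set r : E → ℝ := fun e => if 0 < z e then (1 - x e) / z e else x e / (- z e) with hr
  obtain ⟨e1, he1⟩ : ∃ e, z e ≠ 0 := by
    by_contra h
    push Not at h
    exact hz0 (funext h)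
  obtain ⟨e0, he0, hmin⟩ := Finset.exists_min_image
    (Finset.univ.filter (fun e => z e ≠ 0)) r ⟨e1, by simp [he1]⟩
  simp only [Finset.mem_filter, Finset.mem_univ, true_and] at he0 hmin
  have hpos : 0 ≤ r e0 := by
    simp only [hr]
    split_ifs with h
    · exact div_nonneg (by linarith [(hx e0).2]) h.le
    · exact div_nonneg (hx e0).1 (by linarith)
  have hb : ∀ e, 0 ≤ x e + r e0 * z e ∧ x e + r e0 * z e ≤ 1 := by
    intro e
    rcases lt_trichotomy (z e) 0 with h | h | h
    · have h1 := hmin e h.ne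
      have h2 : r e = x e / (- z e) := by simp [hr, not_lt.2 h.le]
      rw [h2, le_div_iff₀ (by linarith)] at h1
      constructor
      · linarith
      · nlinarith [(hx e).2]
    · rw [h]; simpa using hx e
    · have h1 := hmin e h.ne'
      have h2 : r e = (1 - x e) / z e := by simp [hr, h]
      rw [h2, le_div_iff₀ h] at h1
      constructor
      · nlinarith [(hx e).1]
      · linarith
  refine ⟨r e0, hb, ?_⟩
  rw [Finset.ssubset_iff_of_subset]
  · refine ⟨e0, ?_, ?_⟩
    · by_contra h
      exact he0 (hz e0 h)
    · rw [mem_frc]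
      rcases lt_or_gt_of_ne he0 with h | h
      · have h2 : r e0 = x e0 / (- z e0) := by simp [hr, not_lt.2 h.le]
        have : x e0 + r e0 * z e0 = 0 := by rw [h2]; field_simp; ring
        rw [this]; simp
      · have h2 : r e0 = (1 - x e0) / z e0 := by simp [hr, h]
        have : x e0 + r e0 * z e0 = 1 := by rw [h2]; field_simp; ring
        rw [this]; simp
  · intro e he
    by_contra h
    rw [mem_frc, hz e h] at he
    rw [mem_frc] at h
    simp at he
    exact h he

theorem round_lem {E W : Type*} [Fintype E] [AddCommGroup W] [Module ℝ W]
    (L : (E → ℝ) →ₗ[ℝ] W) (k : ℕ) : ∀ (x : E → ℝ), (frc x).card ≤ k →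
    (∀ e, 0 ≤ x e ∧ x e ≤ 1) →
    ∃ y : E → ℝ, (∀ e, 0 ≤ y e ∧ y e ≤ 1) ∧ (∀ e, e ∉ frc x → y e = x e) ∧ L y = L x ∧
      ∀ z : E → ℝ, (∀ e, e ∉ frc y → z e = 0) → L z = 0 → z = 0 := by
  induction k with
  | zero =>
    intro x hk hx
    refine ⟨x, hx, fun _ _ => rfl, rfl, fun z hz _ => ?_⟩
    have : frc x = ∅ := by simpa using hk
    funext e
    exact hz e (by simp [this])
  | succ k ih =>
    intro x hk hx
    by_cases h : ∀ z : E → ℝ, (∀ e, e ∉ frc x → z e = 0) → L z = 0 → z = 0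
    · exact ⟨x, hx, fun _ _ => rfl, rfl, h⟩
    · push Not at h
      obtain ⟨z, hz, hLz, hz0⟩ := h
      obtain ⟨t, ht, hs⟩ := move_lem x z hx hz hz0
      obtain ⟨y, h1, h2, h3, h4⟩ := ih (fun e => x e + t * z e)
        (by have := Finset.card_lt_card hs; omega) ht
      refine ⟨y, h1, ?_, ?_, h4⟩
      · intro e he
        rw [h2 e (fun h => he (hs.1 h)), hz e he]; simp
      · rw [h3]
        have : (fun e => x e + t * z e) = x + t • z := by ext; simp
        rw [this, map_add, map_smul, hLz]; simp

theorem frac_ne_one {I : Type*} [Fintype I] (h : I → ℝ) (h01 : ∀ i, 0 ≤ h i ∧ h i ≤ 1)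
    (a : ℤ) (hs : ∑ i, h i = a) : (frc h).card ≠ 1 := by
  classical
  intro hc
  obtain ⟨i0, hi0⟩ := Finset.card_eq_one.1 hc
  have h0 : 0 < h i0 ∧ h i0 < 1 := by rw [← mem_frc, hi0]; simp
  have hint : ∀ i ∈ Finset.univ.erase i0, h i = ((if h i = 1 then 1 else 0 : ℤ) : ℝ) := by
    intro i hi
    have : i ∉ frc h := by rw [hi0]; simpa using hi
    rw [mem_frc] at this
    split_ifs with h1
    · simp [h1]
    · have h2 := (h01 i).1
      have h3 := lt_of_le_of_ne (h01 i).2 h1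
      have : ¬ 0 < h i := fun h => this ⟨h, h3⟩
      simp; linarith
  rw [← Finset.add_sum_erase _ _ (Finset.mem_univ i0), Finset.sum_congr rfl hint,
    ← Int.cast_sum] at hs
  set T := ∑ i ∈ Finset.univ.erase i0, (if h i = 1 then 1 else 0 : ℤ)
  have h5 : h i0 = ((a - T : ℤ) : ℝ) := by push_cast; linarith
  rw [h5] at h0
  have h6 : 0 < a - T := by exact_mod_cast h0.1
  have h7 : a - T < 1 := by exact_mod_cast h0.2
  omega

/-- degree map -/
noncomputable def dg (n : ℕ) : ((Fin n × Fin n) → ℝ) →ₗ[ℝ] (Fin n → ℝ) where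
  toFun z v := ∑ w, (z (v, w) + z (w, v))
  map_add' x y := by
    ext v; simp only [Pi.add_apply]; rw [← Finset.sum_add_distrib]
    exact Finset.sum_congr rfl fun _ _ => by ring
  map_smul' t x := by
    ext v; simp only [Pi.smul_apply, smul_eq_mul, RingHom.id_apply]; rw [Finset.mul_sum]
    exact Finset.sum_congr rfl fun _ _ => by ring

theorem dg_apply {n : ℕ} (z : (Fin n × Fin n) → ℝ) (v : Fin n) :
    dg n z v = ∑ w, (z (v, w) + z (w, v)) := rfl

/-- indicator of fractional set -/
noncomputable def ind {E : Type*} [Fintype E] (x : E → ℝ) : E → ℝ := fun e =>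
  open Classical in if e ∈ frc x then 1 else 0

theorem dg_sum {n : ℕ} (z : (Fin n × Fin n) → ℝ) (g : Fin n → ℝ) :
    ∑ v, dg n z v * g v = ∑ p : Fin n × Fin n, z p * (g p.1 + g p.2) := by
  simp only [dg_apply, Finset.sum_add_distrib, add_mul, mul_add, Fintype.sum_prod_type,
    Finset.sum_mul]
  congr 1
  rw [Finset.sum_comm]

/-- touched vertices -/
noncomputable def vf {n : ℕ} (x : (Fin n × Fin n) → ℝ) : Finset (Fin n) :=
  Finset.univ.filter (fun v => 0 < dg n (ind x) v)

theorem dg_ind_ge {n : ℕ} (x : (Fin n × Fin n) → ℝ) (hx : ∀ e, 0 ≤ x e ∧ x e ≤ 1)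
    (a : ℕ) (v : Fin n) (hv : dg n x v = a) (hvf : v ∈ vf x) : 2 ≤ dg n (ind x) v := by
  classical
  set h : Fin n ⊕ Fin n → ℝ := Sum.elim (fun w => x (v, w)) (fun w => x (w, v)) with hh
  have h1 : ∑ i, h i = ((a : ℤ) : ℝ) := by
    rw [Fintype.sum_sum_type, ← Finset.sum_add_distrib]
    simpa [hh, dg_apply] using hv
  have h01 : ∀ i, 0 ≤ h i ∧ h i ≤ 1 := by
    rintro (i | i) <;> simp only [hh, Sum.elim_inl, Sum.elim_inr] <;> exact hx _
  have h2 := frac_ne_one h h01 a h1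
  have h3 : dg n (ind x) v = (frc h).card := by
    rw [Finset.card_eq_sum_ones, dg_apply, frc, Finset.sum_filter, Fintype.sum_sum_type,
      ← Finset.sum_add_distrib]
    push_cast
    refine Finset.sum_congr rfl fun w _ => ?_
    simp [ind, mem_frc, hh]
  have h4 : 0 < dg n (ind x) v := by simpa [vf] using hvf
  rw [h3] at h4 ⊢
  have : 0 < (frc h).card := by exact_mod_cast h4
  have : 2 ≤ (frc h).card := by omega
  exact_mod_cast this

theorem dg_zero {n : ℕ} (x z : (Fin n × Fin n) → ℝ) (hz : ∀ e, e ∉ frc x → z e = 0)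
    (v : Fin n) (hv : v ∉ vf x) : dg n z v = 0 := by
  classical
  have h0 : ∀ e, 0 ≤ ind x e := by intro e; simp only [ind]; split_ifs <;> norm_num
  have h1 : dg n (ind x) v ≤ 0 := by simpa [vf] using hv
  rw [dg_apply] at h1 ⊢
  have h2 := (Finset.sum_eq_zero_iff_of_nonneg (fun w _ => add_nonneg (h0 (v,w)) (h0 (w,v)))).1
    (le_antisymm h1 (Finset.sum_nonneg fun w _ => add_nonneg (h0 (v,w)) (h0 (w,v))))
  refine Finset.sum_eq_zero fun w hw => ?_
  have h3 := h2 w hw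
  have h4 : ind x (v, w) = 0 := by linarith [h0 (v,w), h0 (w,v)]
  have h5 : ind x (w, v) = 0 := by linarith [h0 (v,w), h0 (w,v)]
  rw [hz (v,w) (by intro h; simp [ind, h] at h4), hz (w,v) (by intro h; simp [ind, h] at h5)]
  simp

theorem sum_ind {E : Type*} [Fintype E] (x : E → ℝ) : ∑ e, ind x e = (frc x).card := by
  classical
  simp [ind]

theorem dg_ind_total {n : ℕ} (x : (Fin n × Fin n) → ℝ) :
    ∑ v, dg n (ind x) v = 2 * (frc x).card := by
  have := dg_sum (ind x) (fun _ => 1)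
  simp only [mul_one] at this
  rw [this, ← Finset.sum_mul, sum_ind]; ring

theorem dg_ind_vf {n : ℕ} (x : (Fin n × Fin n) → ℝ) (g : Fin n → ℝ) :
    ∑ v, dg n (ind x) v * g v = ∑ v ∈ vf x, dg n (ind x) v * g v := by
  classical
  symm
  refine Finset.sum_subset (Finset.subset_univ _) fun v _ hv => ?_
  rw [dg_zero x (ind x) (fun e he => by simp [ind, he]) v hv]; simp

/-- extension by zero from the fractional set -/
noncomputable def ext0 {E : Type*} (F : Finset E) : (F → ℝ) →ₗ[ℝ] (E → ℝ) where
  toFun z e := open Classical in if h : e ∈ F then z ⟨e, h⟩ else 0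
  map_add' x y := by ext e; by_cases h : e ∈ F <;> simp [h]
  map_smul' t x := by ext e; by_cases h : e ∈ F <;> simp [h]

theorem ext0_notMem {E : Type*} (F : Finset E) (z : F → ℝ) (e : E) (h : e ∉ F) :
    ext0 F z e = 0 := by simp [ext0, h]

theorem ext0_inj {E : Type*} (F : Finset E) (z : F → ℝ) (h : ext0 F z = 0) : z = 0 := by
  ext ⟨e, he⟩
  have := congrFun h e
  simpa [ext0, he] using this

theorem stage1_card {n : ℕ} {J : Type*} [Fintype J]
    (M : ((Fin n × Fin n) → ℝ) →ₗ[ℝ] (J → ℝ)) (y : (Fin n × Fin n) → ℝ)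
    (hy : ∀ z : (Fin n × Fin n) → ℝ, (∀ e, e ∉ frc y → z e = 0) → (dg n).prod M z = 0 → z = 0) :
    (frc y).card ≤ (vf y).card + Fintype.card J := by
  let R : (Fin n → ℝ) →ₗ[ℝ] (vf y → ℝ) := LinearMap.funLeft ℝ ℝ (fun v : vf y => (v : Fin n))
  let T : (frc y → ℝ) →ₗ[ℝ] ((vf y → ℝ) × (J → ℝ)) :=
    (((R ∘ₗ dg n)).prod M) ∘ₗ ext0 (frc y)
  have hT : Function.Injective T := by
    rw [← LinearMap.ker_eq_bot, LinearMap.ker_eq_bot']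
    intro z hz
    apply ext0_inj
    have hsup : ∀ e, e ∉ frc y → ext0 (frc y) z e = 0 := fun e he => ext0_notMem _ _ _ he
    apply hy _ hsup
    have h1 : R (dg n (ext0 (frc y) z)) = 0 := congrArg Prod.fst hz
    have h2 : M (ext0 (frc y) z) = 0 := congrArg Prod.snd hz
    refine Prod.ext ?_ h2
    ext v
    by_cases hv : v ∈ vf y
    · exact congrFun h1 ⟨v, hv⟩
    · exact dg_zero y _ hsup v hv
  have := LinearMap.finrank_le_finrank_of_injective hT
  simpa using this

theorem two_vf_le {n : ℕ} (x : (Fin n × Fin n) → ℝ) (hx : ∀ e, 0 ≤ x e ∧ x e ≤ 1)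
    (a : ℕ) (hv : ∀ v, dg n x v = a) : (vf x).card ≤ (frc x).card := by
  have h1 := dg_ind_total x
  have h2 := dg_ind_vf x (fun _ => 1)
  simp only [mul_one] at h2
  have h3 : ∑ v ∈ vf x, (2 : ℝ) ≤ ∑ v ∈ vf x, dg n (ind x) v :=
    Finset.sum_le_sum fun v hvf => dg_ind_ge x hx a v (hv v) hvf
  rw [← h2, h1] at h3
  simp at h3
  have : ((vf x).card : ℝ) ≤ (frc x).card := by linarith
  exact_mod_cast this

theorem stage2_int {n : ℕ} (s : Fin n → ℝ) (hs : ∀ v, s v ≠ 0)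
    (y : (Fin n × Fin n) → ℝ) (h01 : ∀ e, 0 ≤ y e ∧ y e ≤ 1)
    (a : ℕ) (hdeg : ∀ v, dg n y v = a)
    (hsupp : ∀ p, y p ≠ 0 → s p.1 + s p.2 = 0)
    (hy : ∀ z : (Fin n × Fin n) → ℝ, (∀ e, e ∉ frc y → z e = 0) → dg n z = 0 → z = 0) :
    frc y = ∅ := by
  classical
  by_contra hne
  have hle := two_vf_le y h01 a hdeg
  let R : (Fin n → ℝ) →ₗ[ℝ] (vf y → ℝ) := LinearMap.funLeft ℝ ℝ (fun v : vf y => (v : Fin n))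
  let T : (frc y → ℝ) →ₗ[ℝ] (vf y → ℝ) := (R ∘ₗ dg n) ∘ₗ ext0 (frc y)
  have hT : Function.Injective T := by
    rw [← LinearMap.ker_eq_bot, LinearMap.ker_eq_bot']
    intro z hz
    apply ext0_inj
    have hsup : ∀ e, e ∉ frc y → ext0 (frc y) z e = 0 := fun e he => ext0_notMem _ _ _ he
    apply hy _ hsup
    ext v
    by_cases hv : v ∈ vf y
    · exact congrFun hz ⟨v, hv⟩
    · exact dg_zero y _ hsup v hv
  have h1 := LinearMap.finrank_le_finrank_of_injective hT
  simp at h1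
  have hsurj : Function.Surjective T :=
    (LinearMap.injective_iff_surjective_of_finrank_eq_finrank (by simp; omega)).1 hT
  have hvne : (vf y).Nonempty := by
    rw [← Finset.card_pos]
    have := Finset.card_pos.2 (Finset.nonempty_iff_ne_empty.2 hne)
    omega
  obtain ⟨v0, hv0⟩ := hvne
  obtain ⟨z, hz⟩ := hsurj (Pi.single ⟨v0, hv0⟩ 1)
  have hsup : ∀ e, e ∉ frc y → ext0 (frc y) z e = 0 := fun e he => ext0_notMem _ _ _ he
  have h2 := dg_sum (ext0 (frc y) z) s
  have h3 : ∑ p : Fin n × Fin n, ext0 (frc y) z p * (s p.1 + s p.2) = 0 := by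
    refine Finset.sum_eq_zero fun p _ => ?_
    by_cases hp : p ∈ frc y
    · rw [hsupp p ((mem_frc y p).1 hp).1.ne']; simp
    · rw [hsup p hp]; simp
  rw [h3, Finset.sum_eq_single v0] at h2
  · have : dg n (ext0 (frc y) z) v0 = 1 := by
      have := congrFun hz ⟨v0, hv0⟩
      rw [Pi.single_eq_same] at this
      exact this
    rw [this, one_mul] at h2
    exact hs v0 h2
  · intro v _ hv
    by_cases hvf : v ∈ vf y
    · have : dg n (ext0 (frc y) z) v = 0 := by
        have := congrFun hz ⟨v, hvf⟩
        rw [Pi.single_eq_of_ne (by simpa using hv)] at this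
        exact this
      rw [this]; simp
    · rw [dg_zero y _ hsup v hvf]; simp
  · simp

theorem diff_bound {n : ℕ} (x y : (Fin n × Fin n) → ℝ) (hx : ∀ e, 0 ≤ x e ∧ x e ≤ 1)
    (hy : ∀ e, 0 ≤ y e ∧ y e ≤ 1) (hxy : ∀ e, e ∉ frc x → y e = x e)
    (a : ℕ) (hv : ∀ v, dg n x v = a) (g : Fin n → ℝ) (B : ℝ) (hB0 : 0 ≤ B) (hB : ∀ v, g v ^ 2 ≤ B)
    (hg : ∑ v, g v ^ 2 ≤ 1) (N : ℕ) (hN : (frc x).card ≤ (vf x).card + N) :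
    2 * |∑ p : Fin n × Fin n, (y p - x p) * (g p.1 * g p.2)| ≤ 2 + 2 * N * B := by
  classical
  have h1 : 2 * |∑ p : Fin n × Fin n, (y p - x p) * (g p.1 * g p.2)| ≤
      ∑ p : Fin n × Fin n, ind x p * (g p.1 ^ 2 + g p.2 ^ 2) := by
    refine (mul_le_mul_of_nonneg_left (Finset.abs_sum_le_sum_abs _ _) (by norm_num)).trans ?_
    rw [Finset.mul_sum]
    refine Finset.sum_le_sum fun p _ => ?_
    by_cases hp : p ∈ frc x
    · simp only [ind, hp, if_true, one_mul]
      rw [abs_mul]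
      have h1 : |y p - x p| ≤ 1 := abs_le.2 ⟨by linarith [(hx p).2, (hy p).1], by
        linarith [(hx p).1, (hy p).2]⟩
      have h2 : 2 * |g p.1 * g p.2| ≤ g p.1 ^ 2 + g p.2 ^ 2 := by
        rw [abs_mul, ← sq_abs (g p.1), ← sq_abs (g p.2)]
        nlinarith [sq_nonneg (|g p.1| - |g p.2|)]
      nlinarith [abs_nonneg (g p.1 * g p.2)]
    · rw [hxy p hp]; simp [ind, hp]
  refine h1.trans ?_
  rw [← dg_sum (ind x) (fun v => g v ^ 2), dg_ind_vf]
  have h2 : ∑ v ∈ vf x, dg n (ind x) v * g v ^ 2 ≤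
      ∑ v ∈ vf x, (2 * g v ^ 2 + (dg n (ind x) v - 2) * B) := by
    refine Finset.sum_le_sum fun v hvf => ?_
    have := dg_ind_ge x hx a v (hv v) hvf
    nlinarith [hB v]
  refine h2.trans ?_
  rw [Finset.sum_add_distrib, ← Finset.mul_sum, ← Finset.sum_mul, Finset.sum_sub_distrib]
  have h3 : ∑ v ∈ vf x, dg n (ind x) v = 2 * (frc x).card := by
    rw [← dg_ind_total]
    have h2 := dg_ind_vf x (fun _ => 1)
    simp only [mul_one] at h2
    exact h2.symm
  rw [h3]
  have h4 : ∑ v ∈ vf x, g v ^ 2 ≤ 1 :=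
    (Finset.sum_le_sum_of_subset_of_nonneg (Finset.subset_univ _)
      fun _ _ _ => sq_nonneg _).trans hg
  have h5 : (((frc x).card : ℕ) : ℝ) ≤ (vf x).card + N := by exact_mod_cast hN
  simp only [Finset.sum_const, nsmul_eq_mul]
  nlinarith

theorem quad_ext {n : ℕ} {S : Type*} [Fintype S] [DecidableEq S] (f : Fin n ↪ S)
    (A : Matrix (Fin n) (Fin n) ℝ) (v : S → ℝ) :
    v ⬝ᵥ (extendMat f A).mulVec v = ∑ x, ∑ y, A x y * (v (f x) * v (f y)) := by
  simp only [dotProduct, mulVec, extendMat, Matrix.of_apply, Finset.mul_sum, Finset.sum_mul]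
  have h1 : ∀ x y : Fin n, ∑ s : S, ∑ t : S,
      v s * ((if f x = s ∧ f y = t then A x y else 0) * v t) = A x y * (v (f x) * v (f y)) := by
    intro x y
    rw [Finset.sum_eq_single (f x), Finset.sum_eq_single (f y)]
    · simp; ring
    · intro t _ ht; simp [ht.symm]
    · simp
    · intro t _ ht; simp [ht.symm]
    · simp
  simp_rw [← h1]
  rw [Finset.sum_congr rfl fun s _ => Finset.sum_comm]
  rw [Finset.sum_comm]
  refine Finset.sum_congr rfl fun x _ => ?_
  rw [Finset.sum_congr rfl fun s _ => Finset.sum_comm]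
  rw [Finset.sum_comm]

theorem quad_adj {n : ℕ} {S : Type*} [Fintype S] [DecidableEq S] (f : Fin n ↪ S)
    (H : SimpleGraph (Fin n)) (z : (Fin n × Fin n) → ℝ)
    (hz : ∀ v w, adjMat H v w = z (v, w) + z (w, v)) (v : S → ℝ) :
    v ⬝ᵥ (extendMat f (adjMat H)).mulVec v =
      2 * ∑ p : Fin n × Fin n, z p * (v (f p.1) * v (f p.2)) := by
  rw [quad_ext, Fintype.sum_prod_type, two_mul]
  simp only [hz, add_mul, Finset.sum_add_distrib]
  congr 1
  rw [Finset.sum_comm]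
  refine Finset.sum_congr rfl fun x _ => Finset.sum_congr rfl fun y _ => ?_
  ring

theorem deg_adj {n : ℕ} (H : SimpleGraph (Fin n)) (z : (Fin n × Fin n) → ℝ)
    (hz : ∀ v w, adjMat H v w = z (v, w) + z (w, v)) (v : Fin n) :
    (deg H v : ℝ) = dg n z v := by
  classical
  rw [dg_apply, ← Finset.sum_congr rfl fun w _ => hz v w]
  have h1 : ∀ w, adjMat H v w = if H.Adj v w then 1 else 0 := by
    intro w
    unfold adjMat
    rw [SimpleGraph.adjMatrix_apply]
  simp only [h1, deg]
  rw [← SimpleGraph.card_neighborFinset_eq_degree, Finset.card_eq_sum_ones]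
  push_cast
  rw [← Finset.sum_filter]
  refine Finset.sum_congr ?_ fun _ _ => rfl
  ext w; simp

/-- the family of linear functionals -/
noncomputable def mm {n m : ℕ} (h : Fin m → Fin n → ℝ) :
    ((Fin n × Fin n) → ℝ) →ₗ[ℝ] (Fin m × Fin m → ℝ) where
  toFun z ij := ∑ p, z p * (h ij.1 p.1 * h ij.2 p.2)
  map_add' x y := by
    ext v; simp only [Pi.add_apply]; rw [← Finset.sum_add_distrib]
    exact Finset.sum_congr rfl fun _ _ => by ring
  map_smul' t x := by
    ext v; simp only [Pi.smul_apply, smul_eq_mul, RingHom.id_apply]; rw [Finset.mul_sum]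
    exact Finset.sum_congr rfl fun _ _ => by ring

theorem mm_quad {n m : ℕ} (h : Fin m → Fin n → ℝ) (c : Fin m → ℝ) (z : (Fin n × Fin n) → ℝ)
    (hz : mm h z = 0) :
    ∑ p : Fin n × Fin n, z p * ((∑ i, c i * h i p.1) * (∑ i, c i * h i p.2)) = 0 := by
  have h1 : ∀ i j, ∑ p, z p * (h i p.1 * h j p.2) = 0 := fun i j => congrFun hz (i, j)
  have h2 : ∑ p : Fin n × Fin n, z p * ((∑ i, c i * h i p.1) * (∑ i, c i * h i p.2)) =
      ∑ i, ∑ j, c i * c j * ∑ p, z p * (h i p.1 * h j p.2) := by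
    simp only [Finset.sum_mul_sum]
    simp only [Finset.mul_sum]
    rw [Finset.sum_comm]
    refine Finset.sum_congr rfl fun i _ => ?_
    rw [Finset.sum_comm]
    refine Finset.sum_congr rfl fun j _ => Finset.sum_congr rfl fun p _ => ?_
    ring
  rw [h2]; simp [h1]

theorem core {n a d m' : ℕ} (hd : 0 < d) (had : a ≤ d)
    (G : SimpleGraph (Fin n)) (hbip : Bipartite G) (hreg : IsRegularGraph G d)
    {S : Type*} [Fintype S] [DecidableEq S] (f : Fin n ↪ S) (u : Fin m' → (S → ℝ)) :
    ∃ H : SimpleGraph (Fin n), H ≤ G ∧ IsRegularGraph H a ∧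
      ∀ (c : Fin m' → ℝ) (v : S → ℝ) (B : ℝ), (∀ s, v s = ∑ i, c i * u i s) → v ⬝ᵥ v = 1 →
        0 ≤ B → (∀ s, v s ^ 2 ≤ B) →
        |v ⬝ᵥ (extendMat f (adjMat H) - ((a : ℝ) / d) • extendMat f (adjMat G)).mulVec v| ≤
          2 + 2 * (m' * m' : ℕ) * B := by
  classical
  obtain ⟨C⟩ := hbip
  have hdR : (0 : ℝ) < d := by exact_mod_cast hd
  set b : (Fin n × Fin n) → ℝ := fun p => if G.Adj p.1 p.2 ∧ C p.1 = 0 then 1 else 0 with hb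
  have hCne : ∀ v w, G.Adj v w → (C v = 0 ↔ ¬ C w = 0) := by
    intro v w h
    have := C.valid h
    omega
  have hbG : ∀ v w, adjMat G v w = b (v, w) + b (w, v) := by
    intro v w
    simp only [adjMat, SimpleGraph.adjMatrix_apply, hb]
    by_cases h : G.Adj v w
    · have := hCne v w h
      by_cases h0 : C w = 0 <;> simp [h, h.symm, h0, this]
    · have h' : ¬ G.Adj w v := fun h' => h h'.symm
      simp [h, h']
  set x0 : (Fin n × Fin n) → ℝ := ((a : ℝ) / d) • b with hx0
  have hx001 : ∀ e, 0 ≤ x0 e ∧ x0 e ≤ 1 := by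
    intro e
    have h1 : (a : ℝ) / d ≤ 1 := by rw [div_le_one hdR]; exact_mod_cast had
    have h2 : 0 ≤ (a : ℝ) / d := by positivity
    simp only [hx0, hb, Pi.smul_apply, smul_eq_mul]
    split_ifs <;> simp [h1, h2]
  have hx0deg : ∀ v, dg n x0 v = a := by
    intro v
    rw [hx0, map_smul, Pi.smul_apply, ← deg_adj G b hbG v, hreg v, smul_eq_mul]
    field_simp
  set h : Fin m' → Fin n → ℝ := fun i x => u i (f x) with hh
  obtain ⟨x1, hx101, hx1off, hx1L, hx1k⟩ := round_lem ((dg n).prod (mm h)) _ x0 le_rfl hx001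
  have hd1 : dg n x1 = dg n x0 := congrArg Prod.fst hx1L
  have hM1 : mm h x1 = mm h x0 := congrArg Prod.snd hx1L
  have hx1deg : ∀ v, dg n x1 v = a := fun v => by rw [hd1, hx0deg]
  have hcard := stage1_card (mm h) x1 hx1k
  obtain ⟨y, hy01, hyoff, hyL, hyk⟩ := round_lem (dg n) _ x1 le_rfl hx101
  have hydeg : ∀ v, dg n y v = a := fun v => by rw [hyL, hx1deg]
  have hsupp1 : ∀ p, b p = 0 → x1 p = 0 := by
    intro p hp
    have h0 : x0 p = 0 := by simp [hx0, hp]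
    rw [hx1off p (by rw [mem_frc, h0]; simp), h0]
  have hsupp : ∀ p, y p ≠ 0 → G.Adj p.1 p.2 ∧ C p.1 = 0 := by
    intro p hp
    by_contra hc
    have h0 : x1 p = 0 := hsupp1 p (by simp only [hb]; rw [if_neg hc])
    exact hp (by rw [hyoff p (by rw [mem_frc, h0]; simp), h0])
  have hint := stage2_int (fun v => if C v = 0 then 1 else -1)
    (fun v => by split_ifs <;> norm_num) y hy01 a hydeg
    (fun p hp => by
      obtain ⟨h1, h2⟩ := hsupp p hp
      have h3 := (hCne _ _ h1).1 h2
      simp [h2, h3]) hyk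
  have hy01' : ∀ p, y p = 0 ∨ y p = 1 := by
    intro p
    by_contra hc
    push Not at hc
    have : p ∈ frc y := (mem_frc y p).2
      ⟨lt_of_le_of_ne (hy01 p).1 hc.1.symm, lt_of_le_of_ne (hy01 p).2 hc.2⟩
    rw [hint] at this; simp at this
  let H : SimpleGraph (Fin n) :=
    { Adj := fun v w => y (v, w) = 1 ∨ y (w, v) = 1
      symm := ⟨fun v w hvw => hvw.symm⟩
      loopless := ⟨fun v hv => by
        have : y (v, v) = 1 := by simpa using hv
        exact G.loopless.irrefl v (hsupp (v, v) (by rw [this]; norm_num)).1⟩ }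
  have hHy : ∀ v w, adjMat H v w = y (v, w) + y (w, v) := by
    intro v w
    have hA : H.Adj v w ↔ (y (v, w) = 1 ∨ y (w, v) = 1) := Iff.rfl
    simp only [adjMat, SimpleGraph.adjMatrix_apply]
    rcases hy01' (v, w) with h1 | h1 <;> rcases hy01' (w, v) with h2 | h2
    · simp [hA, h1, h2]
    · simp [hA, h1, h2]
    · simp [hA, h1, h2]
    · exfalso
      have h3 := hsupp (v, w) (by rw [h1]; norm_num)
      have h4 := hsupp (w, v) (by rw [h2]; norm_num)
      exact (hCne _ _ h3.1).1 h3.2 h4.2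
  refine ⟨H, ?_, ?_, ?_⟩
  · intro v w hvw
    rcases hvw with h1 | h1
    · exact (hsupp (v, w) (by rw [h1]; norm_num)).1
    · exact (hsupp (w, v) (by rw [h1]; norm_num)).1.symm
  · intro v
    have := deg_adj H y hHy v
    rw [hydeg] at this
    exact_mod_cast this
  · intro c v B hv hv1 hB0 hB
    rw [Matrix.sub_mulVec, Matrix.smul_mulVec, dotProduct_sub, dotProduct_smul,
      quad_adj f H y hHy, quad_adj f G b hbG]
    have hz : mm h (x1 - x0) = 0 := by rw [map_sub, hM1, sub_self]
    have h1 := mm_quad h c (x1 - x0) hz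
    simp only [hh, ← hv] at h1
    have h2 := diff_bound x1 y hx101 hy01 hyoff a hx1deg (fun x => v (f x)) B hB0
      (fun x => hB _) ?_ (m' * m') (by simpa using hcard)
    · have h3 : 2 * ∑ p : Fin n × Fin n, y p * (v (f p.1) * v (f p.2)) -
        ((a : ℝ) / d) • (2 * ∑ p : Fin n × Fin n, b p * (v (f p.1) * v (f p.2))) =
        2 * (∑ p : Fin n × Fin n, (y p - x1 p) * (v (f p.1) * v (f p.2))) := by
        have h4 : ∑ p : Fin n × Fin n, (y p - x1 p) * (v (f p.1) * v (f p.2)) =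
          ∑ p : Fin n × Fin n, (y p - x1 p) * (v (f p.1) * v (f p.2)) +
          ∑ p : Fin n × Fin n, (x1 - x0) p * (v (f p.1) * v (f p.2)) := by rw [h1, add_zero]
        rw [h4, ← Finset.sum_add_distrib, smul_eq_mul, mul_left_comm, ← mul_sub, Finset.mul_sum,
          ← Finset.sum_sub_distrib]
        congr 1
        refine Finset.sum_congr rfl fun p _ => ?_
        simp only [hx0, Pi.sub_apply, Pi.smul_apply, smul_eq_mul]
        ring
      rw [h3, abs_mul, abs_two]
      exact h2
    · rw [← hv1, dotProduct]
      have : ∑ x, v (f x) ^ 2 = ∑ s ∈ Finset.univ.map f, v s ^ 2 := by rw [Finset.sum_map]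
      rw [this, Finset.sum_congr rfl fun s _ => (sq (v s)).symm]
      exact Finset.sum_le_sum_of_subset_of_nonneg (Finset.subset_univ _) fun _ _ _ => sq_nonneg _

/-- selecting an `a`-factor `H` of a bipartite `d`-regular graph `G` whose
adjacency matrix is close to `(a/d)A_G` on a subspace `U ⊆ ℝ^S` spanned by orthonormal
vectors of small sup-norm.  Here the finite set `S` containing `V(G)` is modelled by the
embedding `f : Fin n ↪ S`, and `A_H`, `A_G` are extended by zeros to `S × S` matrices. -/
theorem stmt_6 (a d n K m : ℕ) {S : Type*} [Fintype S] [DecidableEq S]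
    (ha : 0 < a) (hd : 0 < d) (had : a ≤ d)
    (G : SimpleGraph (Fin n)) (hbip : Bipartite G) (hreg : IsRegularGraph G d)
    (f : Fin n ↪ S)
    (hK1 : 1 ≤ K) (hKn : K ≤ n) (hm1 : 1 ≤ m) (hmn : m ≤ n)
    (m' : ℕ) (u : Fin m' → (S → ℝ)) (U : Submodule ℝ (S → ℝ))
    (hU : U = Submodule.span ℝ (Set.range u))
    (hdim : Module.finrank ℝ U ≤ m)
    (horth : ∀ i j, i ≠ j → u i ⬝ᵥ u j = 0)
    (hunit : ∀ i, u i ⬝ᵥ u i = 1)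
    (hinf : ∀ i, ‖u i‖ ≤ Real.sqrt ((K : ℝ) / n))
    (hm : max (2 * Real.logb 2 d) 15 ≤ (m : ℝ))
    (hn : K ^ 3 * m ^ 6 ≤ n) :
    ∃ H : SimpleGraph (Fin n), H ≤ G ∧ IsRegularGraph H a ∧
      ∀ v : S → ℝ, v ∈ U → v ⬝ᵥ v = 1 →
        |v ⬝ᵥ (extendMat f (adjMat H) - ((a : ℝ) / d) • extendMat f (adjMat G)).mulVec v| ≤
          7 * Real.sqrt d := by
  classical
  obtain ⟨H, hHG, hHa, hH⟩ := core (a := a) hd had G hbip hreg f u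
  refine ⟨H, hHG, hHa, ?_⟩
  intro v hvU hv1
  rw [hU, Submodule.mem_span_range_iff_exists_fun] at hvU
  obtain ⟨c, hc⟩ := hvU
  have hvs : ∀ s, v s = ∑ i, c i * u i s := by
    intro s; rw [← hc]; simp
  have hdotu : ∀ (b : Fin m' → ℝ) j, (∑ i, b i • u i) ⬝ᵥ u j = b j := by
    intro b j
    rw [sum_dotProduct, Finset.sum_eq_single j]
    · rw [smul_dotProduct, hunit]; simp
    · intro i _ hij; rw [smul_dotProduct, horth i j hij]; simp
    · simp
  have hli : LinearIndependent ℝ u := by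
    rw [Fintype.linearIndependent_iff]
    intro b hb j
    rw [← hdotu b j, hb]; simp
  have hm' : m' ≤ m := by
    rw [hU, finrank_span_eq_card hli] at hdim
    simpa using hdim
  have hc1 : ∑ i, c i ^ 2 = 1 := by
    rw [← hv1]
    conv_rhs => rw [← hc, dotProduct_sum]
    refine Finset.sum_congr rfl fun i _ => ?_
    rw [dotProduct_smul, hdotu, smul_eq_mul, sq]
  have hmR : (15 : ℝ) ≤ m := (le_max_right _ _).trans hm
  have hnpos : (0 : ℝ) < n := by
    have : (m : ℝ) ≤ n := by exact_mod_cast hmn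
    linarith
  have hKR : (1 : ℝ) ≤ K := by exact_mod_cast hK1
  have hB : ∀ s, v s ^ 2 ≤ (m : ℝ) * (K / n) := by
    intro s
    rw [hvs s]
    refine (Finset.sum_mul_sq_le_sq_mul_sq _ _ _).trans ?_
    rw [hc1, one_mul]
    have h1 : ∀ i ∈ Finset.univ, u i s ^ 2 ≤ (K : ℝ) / n := by
      intro i _
      have h2 : |u i s| ≤ Real.sqrt ((K : ℝ) / n) := (norm_le_pi_norm (u i) s).trans (hinf i)
      rw [← sq_abs, ← Real.sq_sqrt (show (0 : ℝ) ≤ (K : ℝ) / n by positivity)]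
      exact pow_le_pow_left₀ (abs_nonneg _) h2 2
    refine (Finset.sum_le_sum h1).trans ?_
    simp only [Finset.sum_const, Finset.card_univ, Fintype.card_fin, nsmul_eq_mul]
    have : (m' : ℝ) ≤ m := by exact_mod_cast hm'
    exact mul_le_mul_of_nonneg_right this (by positivity)
  refine (hH c v _ hvs hv1 (by positivity) hB).trans ?_
  have h3 : ((m' * m' : ℕ) : ℝ) * ((m : ℝ) * (K / n)) ≤ 1 := by
    have h4 : ((m' * m' : ℕ) : ℝ) ≤ (m : ℝ) * m := by exact_mod_cast Nat.mul_le_mul hm' hm'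
    refine (mul_le_mul_of_nonneg_right h4 (by positivity)).trans ?_
    have h5 : (m : ℝ) * m * (m * (K / n)) = (m * m * m * K) / n := by ring
    rw [h5, div_le_one hnpos]
    have h6 : m * m * m * K ≤ n := by
      refine le_trans ?_ hn
      calc m * m * m * K = K ^ 1 * m ^ 3 := by ring
        _ ≤ K ^ 3 * m ^ 6 := Nat.mul_le_mul (Nat.pow_le_pow_right hK1 (by norm_num))
            (Nat.pow_le_pow_right hm1 (by norm_num))
    exact_mod_cast h6
  have h7 : (1 : ℝ) ≤ Real.sqrt d := by
    rw [Real.one_le_sqrt]; exact_mod_cast hd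
  nlinarith
end

section
/- Let d ≥ 22000 be an integer and let a = ⌈12√d⌉. Let G be a bipartite d-regular graph on n vertices with λ₂(A_G) ≤ d − 2a. Suppose that at most m eigenvalues of A_G (counted with multiplicity) are greater than 2√(d−1), and that A_G possesses an orthonormal eigenbasis in which every eigenvector with eigenvalue greater than 2√(d−1) has all entries at most √(m/n) in absolute value. If m ≥ 2·log₂ d and n > m⁹, then there exists an a-factor H of G such that λ₁(A_G − 2A_H) = d − 2a. -/
open Matrix

/-- The eigenvalues of a real (symmetric) matrix, i.e. the real roots of its characteristic
polynomial with multiplicity, listed in decreasing order. -/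
noncomputable def eigList {V : Type*} [Fintype V] [DecidableEq V] (A : Matrix V V ℝ) : List ℝ :=
  (A.charpoly.roots.sort (· ≤ ·)).reverse

/-- `lam A i` is `λ_i(A)`, the `i`-th largest eigenvalue (counted with multiplicity, 1-indexed)
of a real symmetric matrix `A`. -/
noncomputable def lam {V : Type*} [Fintype V] [DecidableEq V] (A : Matrix V V ℝ) (i : ℕ) : ℝ :=
  (eigList A).getD (i - 1) 0


theorem move_aux {E : Type*} [Fintype E] (x y : E → ℝ)
    (hx : ∀ e, 0 ≤ x e ∧ x e ≤ 1) (hy : ∀ e, ¬ (0 < x e ∧ x e < 1) → y e = 0) (hy0 : y ≠ 0) :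
    ∃ τ : ℝ, (∀ e, 0 ≤ x e + τ * y e ∧ x e + τ * y e ≤ 1) ∧
      ∃ e, (0 < x e ∧ x e < 1) ∧ ¬ (0 < x e + τ * y e ∧ x e + τ * y e < 1) := by
  classical
  let g : E → ℝ := fun e => if 0 < y e then (1 - x e) / y e else x e / (- y e)
  let S := Finset.univ.filter fun e => y e ≠ 0
  have hS : S.Nonempty := by
    obtain ⟨e, he⟩ := Function.ne_iff.mp hy0
    exact ⟨e, by simpa [S] using he⟩
  obtain ⟨e0, he0, hmin⟩ := S.exists_min_image g hS
  have hpos : ∀ e ∈ S, 0 < g e := by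
    intro e he
    have hne : y e ≠ 0 := by simpa [S] using he
    have hfr : 0 < x e ∧ x e < 1 := by
      by_contra h
      exact hne (hy e h)
    simp only [g]
    split_ifs with h
    · exact div_pos (by linarith) h
    · have : y e < 0 := lt_of_le_of_ne (not_lt.mp h) hne
      exact div_pos hfr.1 (by linarith)
  refine ⟨g e0, ?_, e0, ?_, ?_⟩
  · intro e
    by_cases hne : y e = 0
    · simpa [hne] using hx e
    have he : e ∈ S := by simpa [S] using hne
    have h1 := hmin e he
    have h2 := hpos e0 he0
    have h3 := hx e
    rcases lt_or_gt_of_ne hne with h | h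
    · have : g e = x e / (- y e) := by simp [g, not_lt.mpr h.le]
      rw [this, le_div_iff₀ (by linarith)] at h1
      constructor
      · linarith
      · nlinarith
    · have : g e = (1 - x e) / y e := by simp [g, h]
      rw [this, le_div_iff₀ h] at h1
      constructor
      · nlinarith
      · linarith
  · by_contra h
    have : y e0 ≠ 0 := by simpa [S] using he0
    exact this (hy e0 h)
  · have hne : y e0 ≠ 0 := by simpa [S] using he0
    rcases lt_or_gt_of_ne hne with h | h
    · have : g e0 * y e0 = - x e0 := by
        simp only [g, not_lt.mpr h.le, if_false]
        field_simp
      rw [this]; simp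
    · have : g e0 * y e0 = 1 - x e0 := by
        simp only [g, h, if_true]
        field_simp
      rw [this]; simp

theorem exists_min_pt {E W : Type*} [Fintype E] [AddCommGroup W] [Module ℝ W]
    (L : (E → ℝ) →ₗ[ℝ] W) (N : ℕ) : ∀ (x : E → ℝ)
    (_ : ∀ e, 0 ≤ x e ∧ x e ≤ 1) (_ : (Finset.univ.filter fun e => 0 < x e ∧ x e < 1).card ≤ N),
    ∃ x' : E → ℝ, (∀ e, 0 ≤ x' e ∧ x' e ≤ 1) ∧ L x' = L x ∧
      (∀ e, ¬ (0 < x e ∧ x e < 1) → x' e = x e) ∧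
      ∀ y : E → ℝ, (∀ e, ¬ (0 < x' e ∧ x' e < 1) → y e = 0) → L y = 0 → y = 0 := by
  classical
  induction N with
  | zero =>
    intro x hx hN
    refine ⟨x, hx, rfl, fun _ _ => rfl, ?_⟩
    intro y hy _
    funext e
    apply hy
    simp only [Nat.le_zero, Finset.card_eq_zero] at hN
    intro h
    have : e ∈ (Finset.univ.filter fun e => 0 < x e ∧ x e < 1) := by simpa using h
    rw [hN] at this
    simp at this
  | succ N ih =>
    intro x hx hN
    by_cases hmin : ∀ y : E → ℝ, (∀ e, ¬ (0 < x e ∧ x e < 1) → y e = 0) → L y = 0 → y = 0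
    · exact ⟨x, hx, rfl, fun _ _ => rfl, hmin⟩
    · push Not at hmin
      obtain ⟨y, hy, hLy, hy0⟩ := hmin
      obtain ⟨τ, h1, e0, h2, h3⟩ := move_aux x y hx (by simpa using hy) hy0
      have hfix : ∀ e, ¬ (0 < x e ∧ x e < 1) → (x + τ • y) e = x e := by
        intro e he
        have : y e = 0 := by simpa using hy e (by simpa using he)
        simp [this]
      have hc : (Finset.univ.filter fun e => 0 < (x + τ • y) e ∧ (x + τ • y) e < 1).card ≤ N := by
        have : (Finset.univ.filter fun e => 0 < (x + τ • y) e ∧ (x + τ • y) e < 1) ⊂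
            (Finset.univ.filter fun e => 0 < x e ∧ x e < 1) := by
          rw [Finset.ssubset_iff_of_subset]
          · exact ⟨e0, by simpa using h2, by simpa using h3⟩
          · intro e he
            simp only [Finset.mem_filter, Finset.mem_univ, true_and] at he ⊢
            by_contra h
            rw [hfix e h] at he
            exact h he
        have := Finset.card_lt_card this
        omega
      obtain ⟨x', g1, g2, g3, g4⟩ := ih (x + τ • y) (by simpa using h1) hc
      refine ⟨x', g1, ?_, ?_, g4⟩
      · rw [g2]; simp [hLy]
      · intro e he
        rw [g3 e (by rw [hfix e he]; exact he), hfix e he]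

/-- degree map -/
noncomputable def incW {E V : Type*} [DecidableEq V] (s t : E → V) (v : V) (e : E) : ℕ :=
  (if s e = v then 1 else 0) + (if t e = v then 1 else 0)

noncomputable def degMap {E V : Type*} [Fintype E] [DecidableEq V] (s t : E → V) :
    (E → ℝ) →ₗ[ℝ] (V → ℝ) where
  toFun x := fun v => ∑ e, (incW s t v e : ℝ) * x e
  map_add' x y := by
    funext v; simp [mul_add, Finset.sum_add_distrib]
  map_smul' r x := by
    funext v; simp [Finset.mul_sum, mul_left_comm]

theorem count_aux {E V K : Type*} [Fintype E] [Fintype K] (D : (E → ℝ) →ₗ[ℝ] (V → ℝ))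
    (L : (E → ℝ) →ₗ[ℝ] (K → ℝ)) (F : Finset E) (T : Finset V)
    (h : ∀ y : E → ℝ, (∀ e, e ∉ F → y e = 0) → (∀ v ∈ T, D y v = 0) → L y = 0 → y = 0) :
    F.card ≤ T.card + Fintype.card K := by
  classical
  let ex : (F → ℝ) →ₗ[ℝ] (E → ℝ) :=
    { toFun := fun y e => if he : e ∈ F then y ⟨e, he⟩ else 0
      map_add' := by
        intro y z; funext e
        by_cases he : e ∈ F <;> simp [he]
      map_smul' := by
        intro r z; funext e
        by_cases he : e ∈ F <;> simp [he] }
  let R : (V → ℝ) →ₗ[ℝ] (T → ℝ) := LinearMap.funLeft ℝ ℝ (fun v : T => (v : V))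
  let Φ : (F → ℝ) →ₗ[ℝ] (T → ℝ) × (K → ℝ) := ((R ∘ₗ D) ∘ₗ ex).prod (L ∘ₗ ex)
  have hinj : Function.Injective Φ := by
    rw [injective_iff_map_eq_zero]
    intro y hy
    have hy1 : R (D (ex y)) = 0 := congrArg Prod.fst hy
    have hy2 : L (ex y) = 0 := congrArg Prod.snd hy
    have h0 : ex y = 0 := by
      apply h
      · intro e he; simp [ex, he]
      · intro v hv
        exact congrFun hy1 ⟨v, hv⟩
      · exact hy2
    funext e
    have := congrFun h0 e
    simpa [ex] using this
  have := LinearMap.finrank_le_finrank_of_injective hinj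
  simpa using this

theorem sum_incW {E V : Type*} [Fintype V] [DecidableEq V] (s t : E → V) (e : E) :
    ∑ v, incW s t v e = 2 := by
  simp [incW, Finset.sum_add_distrib]

/-- degree in fractional set is zero or at least two -/
theorem deg_frac {E V : Type*} [Fintype E] [DecidableEq V] (s t : E → V) (x : E → ℝ)
    (F : Finset E) (hF : ∀ e, e ∈ F ↔ 0 < x e ∧ x e < 1)
    (hx : ∀ e, 0 ≤ x e ∧ x e ≤ 1) (v : V) (a : ℤ) (ha : degMap s t x v = a)
    (h0 : ∑ e ∈ F, incW s t v e ≠ 0) : 2 ≤ ∑ e ∈ F, incW s t v e := by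
  classical
  have key : ∃ k : ℤ, ∑ e ∈ F, (incW s t v e : ℝ) * x e = k := by
    have h1 : ∑ e, (incW s t v e : ℝ) * x e = a := ha
    rw [← Finset.sum_add_sum_compl F] at h1
    have h2 : ∑ e ∈ Fᶜ, (incW s t v e : ℝ) * x e
        = ((∑ e ∈ Fᶜ, (incW s t v e : ℤ) * (if x e = 1 then 1 else 0) : ℤ) : ℝ) := by
      push_cast
      apply Finset.sum_congr rfl
      intro e he
      have : ¬ (0 < x e ∧ x e < 1) := by
        rw [← hF]; simpa using he
      have hh := hx e
      by_cases h : x e = 1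
      · simp [h]
      · have : x e = 0 := by
          by_contra h'
          apply this
          exact ⟨lt_of_le_of_ne hh.1 (Ne.symm h'), lt_of_le_of_ne hh.2 h⟩
        simp [this]
    refine ⟨a - ∑ e ∈ Fᶜ, (incW s t v e : ℤ) * (if x e = 1 then 1 else 0), ?_⟩
    rw [h2] at h1
    push_cast at h1 ⊢
    linarith
  obtain ⟨k, hk⟩ := key
  obtain ⟨e0, he0, hne⟩ := Finset.exists_ne_zero_of_sum_ne_zero h0
  have hp : (0:ℝ) < incW s t v e0 := by exact_mod_cast Nat.pos_of_ne_zero hne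
  have l1 : 0 < ∑ e ∈ F, (incW s t v e : ℝ) * x e := by
    apply Finset.sum_pos'
    · intro e he
      exact mul_nonneg (Nat.cast_nonneg _) (hx e).1
    · exact ⟨e0, he0, mul_pos hp ((hF e0).1 he0).1⟩
  have l2 : ∑ e ∈ F, (incW s t v e : ℝ) * x e < ∑ e ∈ F, (incW s t v e : ℝ) := by
    apply Finset.sum_lt_sum
    · intro e he
      exact mul_le_of_le_one_right (Nat.cast_nonneg _) (hx e).2
    · exact ⟨e0, he0, by nlinarith [((hF e0).1 he0).2]⟩
  rw [hk] at l1 l2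
  have m1 : 0 < k := by exact_mod_cast l1
  have m2 : k < ((∑ e ∈ F, incW s t v e : ℕ) : ℤ) := by
    have : (k:ℝ) < ((∑ e ∈ F, incW s t v e : ℕ) : ℝ) := by push_cast; exact l2
    exact_mod_cast this
  omega

theorem excess {E V K : Type*} [Fintype E] [Fintype K] [Fintype V] [DecidableEq V]
    (s t : E → V) (L : (E → ℝ) →ₗ[ℝ] (K → ℝ)) (F : Finset E)
    (hdeg : ∀ v, ∑ e ∈ F, incW s t v e ≠ 0 → 2 ≤ ∑ e ∈ F, incW s t v e)
    (h : ∀ y : E → ℝ, (∀ e, e ∉ F → y e = 0) → degMap s t y = 0 → L y = 0 → y = 0) :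
    ∑ v, (∑ e ∈ F, incW s t v e - 2) ≤ 2 * Fintype.card K := by
  classical
  let T := Finset.univ.filter fun v => ∑ e ∈ F, incW s t v e ≠ 0
  have hc := count_aux (degMap s t) L F T (by
    intro y hy hT hL
    apply h y hy _ hL
    funext v
    by_cases hv : v ∈ T
    · exact hT v hv
    · have hz : ∑ e ∈ F, incW s t v e = 0 := by simpa [T] using hv
      rw [Finset.sum_eq_zero_iff] at hz
      change ∑ e, (incW s t v e : ℝ) * y e = 0
      apply Finset.sum_eq_zero
      intro e _
      by_cases he : e ∈ F
      · simp [hz e he]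
      · simp [hy e he])
  have h2 : ∑ v, ∑ e ∈ F, incW s t v e = 2 * F.card := by
    rw [Finset.sum_comm]
    simp [sum_incW, mul_comm]
  have h3 : ∑ v, ∑ e ∈ F, incW s t v e
      = ∑ v, (∑ e ∈ F, incW s t v e - 2) + ∑ v, (if v ∈ T then 2 else 0) := by
    rw [← Finset.sum_add_distrib]
    apply Finset.sum_congr rfl
    intro v _
    by_cases hv : v ∈ T
    · have := hdeg v (by simpa [T] using hv)
      simp only [hv, if_true]; omega
    · have hz : ∑ e ∈ F, incW s t v e = 0 := by simpa [T] using hv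
      simp [hv, hz]
  have h4 : ∑ v, (if v ∈ T then 2 else 0) = 2 * T.card := by
    simp [mul_comm]
  omega

theorem integral_aux {E V : Type*} [Fintype E] [Fintype V] [DecidableEq V]
    (s t : E → V) (F : Finset E) (c : V → Prop) (hb : ∀ e ∈ F, c (s e) ∧ ¬ c (t e))
    (hdeg : ∀ v, ∑ e ∈ F, incW s t v e ≠ 0 → 2 ≤ ∑ e ∈ F, incW s t v e)
    (h : ∀ y : E → ℝ, (∀ e, e ∉ F → y e = 0) → degMap s t y = 0 → y = 0) : F = ∅ := by
  classical
  by_contra hne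
  obtain ⟨e0, he0⟩ := Finset.nonempty_iff_ne_empty.mpr hne
  let T := Finset.univ.filter fun v => ∑ e ∈ F, incW s t v e ≠ 0
  have hv0 : s e0 ∈ T := by
    simp only [T, Finset.mem_filter, Finset.mem_univ, true_and]
    intro hz
    rw [Finset.sum_eq_zero_iff] at hz
    have := hz e0 he0
    simp [incW] at this
  let σ : V → ℝ := fun v => if c v then 1 else -1
  have hσ : ∀ y : E → ℝ, (∀ e, e ∉ F → y e = 0) → ∑ v, σ v * degMap s t y v = 0 := by
    intro y hy
    have : ∀ v, σ v * degMap s t y v = ∑ e, (σ v * incW s t v e) * y e := by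
      intro v
      change σ v * ∑ e, (incW s t v e : ℝ) * y e = _
      rw [Finset.mul_sum]
      apply Finset.sum_congr rfl; intros; ring
    simp_rw [this]
    rw [Finset.sum_comm]
    apply Finset.sum_eq_zero
    intro e _
    by_cases he : e ∈ F
    · rw [← Finset.sum_mul]
      have : ∑ v, σ v * (incW s t v e : ℝ) = σ (s e) + σ (t e) := by
        simp [incW, mul_add, Finset.sum_add_distrib]
      rw [this]
      simp [σ, hb e he]
    · simp [hy e he]
  have hc := count_aux (K := Empty) (degMap s t) 0 F (T.erase (s e0)) (by
    intro y hy hT _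
    apply h y hy
    have hoff : ∀ v, v ≠ s e0 → degMap s t y v = 0 := by
      intro v hvn
      by_cases hv : v ∈ T
      · exact hT v (Finset.mem_erase.mpr ⟨hvn, hv⟩)
      · have hz : ∑ e ∈ F, incW s t v e = 0 := by simpa [T] using hv
        rw [Finset.sum_eq_zero_iff] at hz
        change ∑ e, (incW s t v e : ℝ) * y e = 0
        apply Finset.sum_eq_zero
        intro e _
        by_cases he : e ∈ F
        · simp [hz e he]
        · simp [hy e he]
    funext v
    by_cases hv : v = s e0
    · have h1 := hσ y hy
      rw [Finset.sum_eq_single (s e0)] at h1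
      · simp only [σ, (hb e0 he0).1, if_true, one_mul] at h1
        rw [hv]; exact h1
      · intro v _ hvn
        rw [hoff v hvn, mul_zero]
      · simp
    · exact hoff v hv)
  have h2 : ∑ v, ∑ e ∈ F, incW s t v e = 2 * F.card := by
    rw [Finset.sum_comm]
    simp [sum_incW, mul_comm]
  have h3 : ∑ v, (if v ∈ T then 2 else 0) ≤ ∑ v, ∑ e ∈ F, incW s t v e := by
    apply Finset.sum_le_sum
    intro v _
    by_cases hv : v ∈ T
    · simpa [hv] using hdeg v (by simpa [T] using hv)
    · simp [hv]
  have h4 : ∑ v, (if v ∈ T then 2 else 0) = 2 * T.card := by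
    simp [mul_comm]
  have h5 := Finset.card_erase_lt_of_mem hv0
  simp at hc
  omega

/-- main rounding theorem -/
theorem rounding {E V K : Type*} [Fintype E] [DecidableEq E] [Fintype V] [DecidableEq V] [Fintype K]
    (s t : E → V) (c : V → Prop) (L : (E → ℝ) →ₗ[ℝ] (K → ℝ)) (x0 : E → ℝ)
    (hx0 : ∀ e, 0 ≤ x0 e ∧ x0 e ≤ 1)
    (hb : ∀ e, 0 < x0 e ∧ x0 e < 1 → c (s e) ∧ ¬ c (t e)) (a : ℕ)
    (ha : ∀ v, degMap s t x0 v = a) :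
    ∃ (x z : E → ℝ) (F : Finset E), (∀ e, z e = 0 ∨ z e = 1) ∧ (∀ v, degMap s t z v = a) ∧
      (∀ e, ¬ (0 < x0 e ∧ x0 e < 1) → z e = x0 e) ∧
      L x = L x0 ∧ (∀ e, |z e - x e| ≤ if e ∈ F then 1 else 0) ∧
      ∑ v, (∑ e ∈ F, incW s t v e - 2) ≤ 2 * Fintype.card K := by
  classical
  obtain ⟨x, x1, x2, x3, x4⟩ := exists_min_pt ((degMap s t).prod L) _ x0 hx0 le_rfl
  have x2d : degMap s t x = degMap s t x0 := congrArg Prod.fst x2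
  have x2L : L x = L x0 := congrArg Prod.snd x2
  obtain ⟨z, z1, z2, z3, z4⟩ := exists_min_pt (degMap s t) _ x x1 le_rfl
  have hxz : ∀ e, ¬ (0 < x0 e ∧ x0 e < 1) → ¬ (0 < x e ∧ x e < 1) := by
    intro e he; rw [x3 e he]; exact he
  have hzz : ∀ e, ¬ (0 < x e ∧ x e < 1) → ¬ (0 < z e ∧ z e < 1) := by
    intro e he; rw [z3 e he]; exact he
  let F := Finset.univ.filter fun e => 0 < x e ∧ x e < 1
  let F' := Finset.univ.filter fun e => 0 < z e ∧ z e < 1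
  have hF' : F' = ∅ := by
    apply integral_aux s t F' c
    · intro e he
      apply hb
      by_contra h
      exact hzz e (hxz e h) (by simpa [F'] using he)
    · intro v hv
      exact deg_frac s t z F' (by simp [F']) z1 v a (by rw [z2, x2d, ha]; simp) hv
    · intro y hy hD
      exact z4 y (fun e he => hy e (by simpa [F'] using he)) hD
  refine ⟨x, z, F, ?_, ?_, ?_, x2L, ?_, ?_⟩
  · intro e
    have : e ∉ F' := by simp [hF']
    have h1 : ¬ (0 < z e ∧ z e < 1) := by simpa [F'] using this
    have h2 := z1 e
    by_contra h
    push Not at h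
    exact h1 ⟨lt_of_le_of_ne h2.1 (Ne.symm h.1), lt_of_le_of_ne h2.2 h.2⟩
  · intro v; rw [z2, x2d, ha]
  · intro e he
    rw [z3 e (hxz e he), x3 e he]
  · intro e
    by_cases he : e ∈ F
    · simp only [he, if_true]
      rw [abs_le]
      constructor <;> linarith [z1 e, x1 e, (z1 e).1, (z1 e).2, (x1 e).1, (x1 e).2]
    · have : ¬ (0 < x e ∧ x e < 1) := by simpa [F] using he
      simp [he, z3 e this]
  · apply excess s t L F
    · intro v hv
      exact deg_frac s t x F (by simp [F]) x1 v a (by rw [x2d, ha]; simp) hv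
    · intro y hy hD hL
      apply x4 y (fun e he => hy e (by simpa [F] using he))
      simp [hD, hL]

theorem two_mul_sum_swap {V : Type*} [Fintype V] (x : V × V → ℝ) (u : V → ℝ) :
    ∑ e, 2 * (x e * (u e.1 * u e.2)) = ∑ v, ∑ w, u v * ((x (v, w) + x (w, v)) * u w) := by
  have h1 : ∑ e, x e * (u e.1 * u e.2) = ∑ v, ∑ w, x (v, w) * (u v * u w) := by
    rw [Fintype.sum_prod_type]
  have h2 : ∑ e, x e * (u e.1 * u e.2) = ∑ v, ∑ w, x (w, v) * (u w * u v) := by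
    rw [Fintype.sum_prod_type_right]
  rw [← Finset.mul_sum, two_mul]
  nth_rewrite 1 [h1]
  rw [h2, ← Finset.sum_add_distrib]
  apply Finset.sum_congr rfl; intro v _
  rw [← Finset.sum_add_distrib]
  apply Finset.sum_congr rfl; intro w _
  ring

open Classical in
theorem adjMat_apply {V : Type*} [Fintype V] (G : SimpleGraph V) (v w : V) :
    adjMat G v w = if G.Adj v w then 1 else 0 := by
  simp [adjMat, SimpleGraph.adjMatrix_apply]

theorem sum_adjMat {V : Type*} [Fintype V] (G : SimpleGraph V) (v : V) :
    ∑ w, adjMat G v w = (deg G v : ℝ) := by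
  classical
  simp only [adjMat_apply, deg]
  rw [Finset.sum_boole]
  congr 1
  rw [← SimpleGraph.card_neighborFinset_eq_degree]
  congr 1
  ext w; simp

theorem form_bound {E V : Type*} [Fintype E] [DecidableEq E] [Fintype V] [DecidableEq V]
    (s t : E → V) (x z : E → ℝ) (F : Finset E) (k : ℕ)
    (h1 : ∀ e, |z e - x e| ≤ if e ∈ F then 1 else 0)
    (h2 : ∑ v, (∑ e ∈ F, incW s t v e - 2) ≤ 2 * k) (u : V → ℝ) (C : ℝ)
    (hC : ∀ v, u v ^ 2 ≤ C) (hC0 : 0 ≤ C) :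
    ∑ e, x e * (u (s e) * u (t e)) - (∑ v, u v ^ 2 + k * C) ≤
      ∑ e, z e * (u (s e) * u (t e)) := by
  have a1 : ∑ e, x e * (u (s e) * u (t e)) - ∑ e, z e * (u (s e) * u (t e))
      ≤ ∑ e ∈ F, (u (s e) ^ 2 + u (t e) ^ 2) / 2 := by
    rw [← Finset.sum_sub_distrib]
    have : ∑ e ∈ F, (u (s e) ^ 2 + u (t e) ^ 2) / 2
        = ∑ e, (if e ∈ F then 1 else 0) * ((u (s e) ^ 2 + u (t e) ^ 2) / 2) := by
      simp
    rw [this]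
    apply Finset.sum_le_sum
    intro e _
    have b1 := h1 e
    have b2 : |u (s e) * u (t e)| ≤ (u (s e) ^ 2 + u (t e) ^ 2) / 2 := by
      rw [abs_le]; constructor <;> nlinarith [sq_nonneg (u (s e) - u (t e)), sq_nonneg (u (s e) + u (t e))]
    calc x e * (u (s e) * u (t e)) - z e * (u (s e) * u (t e))
        = - ((z e - x e) * (u (s e) * u (t e))) := by ring
      _ ≤ |(z e - x e) * (u (s e) * u (t e))| := neg_le_abs _
      _ = |z e - x e| * |u (s e) * u (t e)| := abs_mul _ _
      _ ≤ _ := mul_le_mul b1 b2 (abs_nonneg _) (by split_ifs <;> norm_num)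
  have a2 : ∑ e ∈ F, (u (s e) ^ 2 + u (t e) ^ 2) / 2
      = ∑ v, ((∑ e ∈ F, incW s t v e : ℕ) : ℝ) * (u v ^ 2 / 2) := by
    push_cast
    simp_rw [Finset.sum_mul]
    rw [Finset.sum_comm]
    apply Finset.sum_congr rfl
    intro e _
    simp [incW, add_mul, Finset.sum_add_distrib]
    ring
  have a3 : ∑ v, ((∑ e ∈ F, incW s t v e : ℕ) : ℝ) * (u v ^ 2 / 2)
      ≤ ∑ v, (u v ^ 2 + ((∑ e ∈ F, incW s t v e - 2 : ℕ) : ℝ) * (C / 2)) := by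
    apply Finset.sum_le_sum
    intro v _
    have c1 : ((∑ e ∈ F, incW s t v e : ℕ) : ℝ) ≤ 2 + ((∑ e ∈ F, incW s t v e - 2 : ℕ) : ℝ) := by
      have : (∑ e ∈ F, incW s t v e : ℕ) ≤ 2 + (∑ e ∈ F, incW s t v e - 2 : ℕ) := by omega
      exact_mod_cast this
    have c2 : (0:ℝ) ≤ ((∑ e ∈ F, incW s t v e - 2 : ℕ) : ℝ) := Nat.cast_nonneg _
    nlinarith [mul_le_mul_of_nonneg_right c1 (sq_nonneg (u v)), mul_le_mul_of_nonneg_left (hC v) c2]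
  have a4 : ∑ v, (u v ^ 2 + ((∑ e ∈ F, incW s t v e - 2 : ℕ) : ℝ) * (C / 2))
      ≤ ∑ v, u v ^ 2 + k * C := by
    rw [Finset.sum_add_distrib, ← Finset.sum_mul]
    have : (∑ v, ((∑ e ∈ F, incW s t v e - 2 : ℕ) : ℝ)) ≤ 2 * k := by exact_mod_cast h2
    nlinarith
  linarith

theorem factor_exists {V K0 : Type*} [Fintype V] [DecidableEq V] [Fintype K0]
    (G : SimpleGraph V) (hbip : Bipartite G) (d a : ℕ) (hd : 0 < d) (had : a ≤ d)
    (hreg : IsRegularGraph G d) (b : K0 → V → ℝ) :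
    ∃ H : SimpleGraph V, H ≤ G ∧ IsRegularGraph H a ∧
      ∀ (α : K0 → ℝ) (u : V → ℝ) (C : ℝ), u = ∑ i, α i • b i → (∀ v, u v ^ 2 ≤ C) → 0 ≤ C →
        (a / d : ℝ) * (u ⬝ᵥ (adjMat G).mulVec u)
          - 2 * (∑ v, u v ^ 2 + (Fintype.card K0 ^ 2 : ℕ) * C) ≤ u ⬝ᵥ (adjMat H).mulVec u := by
  classical
  obtain ⟨col⟩ := hbip
  have hd' : (0:ℝ) < d := by exact_mod_cast hd
  have hp0 : (0:ℝ) ≤ a / d := by positivity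
  have hp1 : (a / d : ℝ) ≤ 1 := by
    rw [div_le_one hd']; exact_mod_cast had
  let x0 : V × V → ℝ := fun e => if G.Adj e.1 e.2 ∧ col e.1 = 0 then (a / d : ℝ) else 0
  have hx0s : ∀ v w, x0 (v, w) + x0 (w, v) = (a / d : ℝ) * adjMat G v w := by
    intro v w
    simp only [x0, adjMat_apply]
    by_cases h : G.Adj v w
    · have hne := col.valid h
      have h' := h.symm
      simp only [h, h', true_and, if_true]
      generalize col v = p at *
      generalize col w = q at *
      fin_cases p <;> fin_cases q <;> simp_all
    · have h' : ¬ G.Adj w v := fun h' => h h'.symm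
      simp [h, h']
  have degE : ∀ (x : V × V → ℝ) v, degMap Prod.fst Prod.snd x v = ∑ w, (x (v, w) + x (w, v)) := by
    intro x v
    change ∑ e, (incW Prod.fst Prod.snd v e : ℝ) * x e = _
    simp only [incW, Nat.cast_add, add_mul, Finset.sum_add_distrib]
    congr 1
    · rw [Fintype.sum_prod_type]
      rw [Finset.sum_eq_single v] <;> simp +contextual
    · rw [Fintype.sum_prod_type_right]
      rw [Finset.sum_eq_single v] <;> simp +contextual
  have quad : ∀ (x : V × V → ℝ) (A : Matrix V V ℝ) (hA : ∀ v w, x (v, w) + x (w, v) = A v w)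
      (u : V → ℝ), 2 * ∑ e, x e * (u e.1 * u e.2) = u ⬝ᵥ A.mulVec u := by
    intro x A hA u
    simp only [dotProduct, mulVec, Finset.mul_sum, ← hA]
    rw [two_mul_sum_swap x u]
  let L : (V × V → ℝ) →ₗ[ℝ] (K0 × K0 → ℝ) :=
    { toFun := fun x ij => ∑ e, x e * (b ij.1 e.1 * b ij.2 e.2)
      map_add' := by
        intro x y; funext ij; simp [add_mul, Finset.sum_add_distrib]
      map_smul' := by
        intro r x; funext ij; simp [Finset.mul_sum, mul_assoc] }
  have Lexp : ∀ (x : V × V → ℝ) (α : K0 → ℝ) (u : V → ℝ), u = ∑ i, α i • b i →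
      ∑ e, x e * (u e.1 * u e.2) = ∑ ij : K0 × K0, α ij.1 * α ij.2 * L x ij := by
    intro x α u hu
    have hu' : ∀ v, u v = ∑ i, α i * b i v := by intro v; rw [hu]; simp
    simp only [L, LinearMap.coe_mk, AddHom.coe_mk, Finset.mul_sum]
    rw [Finset.sum_comm]
    apply Finset.sum_congr rfl
    intro e _
    rw [hu', hu', Finset.sum_mul_sum, Fintype.sum_prod_type, Finset.mul_sum]
    apply Finset.sum_congr rfl; intro i _
    rw [Finset.mul_sum]
    apply Finset.sum_congr rfl; intro j _
    ring
  obtain ⟨x, z, F, r1, r2, r3, r4, r5, r6⟩ := rounding Prod.fst Prod.snd (fun v => col v = 0) L x0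
    (by
      intro e
      simp only [x0]
      split_ifs
      · exact ⟨hp0, hp1⟩
      · norm_num)
    (by
      intro e he
      simp only [x0] at he
      split_ifs at he with h
      · refine ⟨h.2, fun h2 => col.valid h.1 (h.2.trans h2.symm)⟩
      · simp at he) a
    (by
      intro v
      rw [degE]
      simp_rw [hx0s]
      rw [← Finset.mul_sum, sum_adjMat, hreg v]
      field_simp)
  have hsupp : ∀ v w, z (v, w) ≠ 0 → G.Adj v w ∧ col v = 0 := by
    intro v w hz
    by_contra h
    have h0 : x0 (v, w) = 0 := by simp only [x0]; rw [if_neg h]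
    apply hz
    rw [r3 _ (by rw [h0]; simp), h0]
  let H : SimpleGraph V :=
    { Adj := fun v w => z (v, w) = 1 ∨ z (w, v) = 1
      symm := ⟨fun v w h => h.symm⟩
      loopless := ⟨by
        intro v h
        have : z (v, v) = 1 := by simpa using h
        exact G.loopless.irrefl v (hsupp v v (by rw [this]; norm_num)).1⟩ }
  have hHG : H ≤ G := by
    intro v w h
    rcases h with h | h
    · exact (hsupp v w (by rw [h]; norm_num)).1
    · exact (hsupp w v (by rw [h]; norm_num)).1.symm
  have hzH : ∀ v w, z (v, w) + z (w, v) = adjMat H v w := by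
    intro v w
    have hA : H.Adj v w ↔ (z (v, w) = 1 ∨ z (w, v) = 1) := Iff.rfl
    simp only [adjMat_apply, hA]
    rcases r1 (v, w) with h | h <;> rcases r1 (w, v) with h' | h'
    · simp [h, h']
    · simp [h, h']
    · simp [h, h']
    · exfalso
      have g1 := hsupp v w (by rw [h]; norm_num)
      have g2 := hsupp w v (by rw [h']; norm_num)
      exact col.valid g1.1 (g1.2.trans g2.2.symm)
  refine ⟨H, hHG, ?_, ?_⟩
  · intro v
    have h1 := r2 v
    rw [degE] at h1
    simp_rw [hzH] at h1
    rw [sum_adjMat] at h1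
    exact_mod_cast h1
  · intro α u C hu hC hC0
    have h1 := form_bound Prod.fst Prod.snd x z F _ r5 r6 u C hC hC0
    have h2 : ∑ e, x e * (u e.1 * u e.2) = ∑ e, x0 e * (u e.1 * u e.2) := by
      rw [Lexp x α u hu, Lexp x0 α u hu, r4]
    have h3 := quad z _ hzH u
    have h4 := quad x0 ((a / d : ℝ) • adjMat G) (by intro v w; rw [hx0s]; simp) u
    rw [smul_mulVec, dotProduct_smul, smul_eq_mul] at h4
    rw [← h3, ← h4, ← h2]
    have : Fintype.card (K0 × K0) = Fintype.card K0 ^ 2 := by simp [sq]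
    rw [this] at h1
    linarith

theorem eigList_sorted {V : Type*} [Fintype V] [DecidableEq V] (A : Matrix V V ℝ) :
    (eigList A).Pairwise (fun x y => y ≤ x) := by
  unfold eigList
  rw [List.pairwise_reverse]
  exact Multiset.pairwise_sort _ _

theorem eigList_coe {V : Type*} [Fintype V] [DecidableEq V] (A : Matrix V V ℝ) :
    ((eigList A : List ℝ) : Multiset ℝ) = A.charpoly.roots := by
  unfold eigList
  rw [Multiset.coe_reverse, Multiset.sort_eq]

theorem mem_eigList {V : Type*} [Fintype V] [DecidableEq V] (A : Matrix V V ℝ) (r : ℝ) :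
    r ∈ eigList A ↔ ∃ v : V → ℝ, v ≠ 0 ∧ A.mulVec v = r • v := by
  rw [← Multiset.mem_coe, eigList_coe, Polynomial.mem_roots A.charpoly_monic.ne_zero,
    Polynomial.IsRoot.def, Matrix.eval_charpoly, ← Matrix.exists_mulVec_eq_zero_iff]
  apply exists_congr
  intro v
  apply and_congr_right
  intro _
  rw [Matrix.sub_mulVec, sub_eq_zero, eq_comm]
  simp [Matrix.scalar_apply]
  
theorem lam_one {V : Type*} [Fintype V] [DecidableEq V] (A : Matrix V V ℝ) (r : ℝ)
    (h1 : ∃ v : V → ℝ, v ≠ 0 ∧ A.mulVec v = r • v)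
    (h2 : ∀ (s : ℝ) (v : V → ℝ), v ≠ 0 → A.mulVec v = s • v → s ≤ r) : lam A 1 = r := by
  have hs := eigList_sorted A
  have hm := mem_eigList A
  unfold lam
  have hr := (hm r).2 h1
  cases h : eigList A with
  | nil => rw [h] at hr; simp at hr
  | cons x l =>
    rw [h] at hs hr hm
    simp only [Nat.sub_self, List.getD_cons_zero]
    obtain ⟨v, hv, hv'⟩ := (hm x).1 (by simp)
    apply le_antisymm (h2 x v hv hv')
    rw [List.pairwise_cons] at hs
    rcases List.mem_cons.mp hr with h | h
    · exact h.le
    · exact hs.1 r h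

theorem charpoly_roots_eq {n : ℕ} (A : Matrix (Fin n) (Fin n) ℝ)
    (b : Fin n → (Fin n → ℝ)) (μ : Fin n → ℝ)
    (heig : ∀ i, A.mulVec (b i) = μ i • b i)
    (horth : ∀ i j, b i ⬝ᵥ b j = if i = j then (1 : ℝ) else 0) :
    A.charpoly.roots = Finset.univ.val.map μ := by
  let B : Matrix (Fin n) (Fin n) ℝ := Matrix.of b
  have hB : B * Bᵀ = 1 := by
    ext i j
    simp [Matrix.mul_apply, B, Matrix.one_apply, ← horth, dotProduct]
  have hB' : Bᵀ * B = 1 := mul_eq_one_comm.mp hB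
  have hA : A * Bᵀ = Bᵀ * Matrix.diagonal μ := by
    ext i j
    have := congrFun (heig j) i
    simp only [Matrix.mul_diagonal]
    simpa [Matrix.mul_apply, mulVec, dotProduct, B, mul_comm] using this
  let U : (Matrix (Fin n) (Fin n) ℝ)ˣ := ⟨Bᵀ, B, hB', hB⟩
  have hA2 : A = U.val * Matrix.diagonal μ * U⁻¹.val := by
    change A = Bᵀ * Matrix.diagonal μ * B
    rw [← hA, Matrix.mul_assoc, hB', Matrix.mul_one]
  rw [hA2, Matrix.coe_units_inv, Matrix.charpoly_units_conj, Matrix.charpoly_diagonal]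
  rw [Polynomial.roots_prod]
  · simp [Multiset.bind_singleton]
  · exact Finset.prod_ne_zero_iff.mpr fun i _ => Polynomial.X_sub_C_ne_zero _

theorem lam_two {n : ℕ} (A : Matrix (Fin n) (Fin n) ℝ)
    (b : Fin n → (Fin n → ℝ)) (μ : Fin n → ℝ)
    (heig : ∀ i, A.mulVec (b i) = μ i • b i)
    (horth : ∀ i j, b i ⬝ᵥ b j = if i = j then (1 : ℝ) else 0) (c : ℝ) (hc : lam A 2 ≤ c)
    (i j : Fin n) (hi : c < μ i) (hj : c < μ j) : i = j := by
  have hs := eigList_sorted A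
  have hco := eigList_coe A
  rw [charpoly_roots_eq A b μ heig horth] at hco
  have hl : ((eigList A).filter (fun x => c < x)).length ≤ 1 := by
    unfold lam at hc
    cases h : eigList A with
    | nil => simp
    | cons x l =>
      rw [h] at hc hs
      cases l with
      | nil => 
        exact le_trans (List.length_filter_le _ _) (by simp)
      | cons y l =>
        have hy : y ≤ c := by simpa using hc
        have : ((y :: l).filter (fun x => c < x)) = [] := by
          rw [List.filter_eq_nil_iff]
          intro z hz
          rw [List.pairwise_cons, List.pairwise_cons] at hs
          rcases List.mem_cons.mp hz with h | h
          · simp [h, hy]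
          · simpa using (hs.2.1 z h).trans hy
        rw [List.filter_cons, this]
        split_ifs <;> simp
  have hcard : (Multiset.filter (fun x => c < x) (Finset.univ.val.map μ)).card ≤ 1 := by
    rw [← hco, Multiset.filter_coe, Multiset.coe_card]
    exact hl
  rw [Multiset.filter_map, Multiset.card_map] at hcard
  have h2 : (Finset.univ.filter fun i => c < μ i).card ≤ 1 := hcard
  exact Finset.card_le_one.mp h2 i (by simpa using hi) j (by simpa using hj)

theorem expand {n : ℕ} (b : Fin n → (Fin n → ℝ))
    (horth : ∀ i j, b i ⬝ᵥ b j = if i = j then (1 : ℝ) else 0) (v : Fin n → ℝ) :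
    v = ∑ i, (b i ⬝ᵥ v) • b i := by
  let B : Matrix (Fin n) (Fin n) ℝ := Matrix.of b
  have hB : B * Bᵀ = 1 := by
    ext i j
    simp [Matrix.mul_apply, B, Matrix.one_apply, ← horth, dotProduct]
  have hB' : Bᵀ * B = 1 := mul_eq_one_comm.mp hB
  have : Bᵀ.mulVec (B.mulVec v) = v := by
    rw [Matrix.mulVec_mulVec, hB', Matrix.one_mulVec]
  conv_lhs => rw [← this]
  ext x
  simp [mulVec, dotProduct, B, mul_comm]

theorem sum_dot {n : ℕ} (b : Fin n → (Fin n → ℝ))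
    (horth : ∀ i j, b i ⬝ᵥ b j = if i = j then (1 : ℝ) else 0) (α β : Fin n → ℝ) :
    (∑ i, α i • b i) ⬝ᵥ (∑ i, β i • b i) = ∑ i, α i * β i := by
  simp only [sum_dotProduct, dotProduct_sum, smul_dotProduct, dotProduct_smul, horth, smul_eq_mul]
  simp [mul_comm]

theorem adjMat_symm {V : Type*} [Fintype V] (G : SimpleGraph V) (v w : V) :
    adjMat G v w = adjMat G w v := by
  classical
  simp [adjMat_apply, G.adj_comm]

theorem adj_dot_symm {V : Type*} [Fintype V] (G : SimpleGraph V) (y z : V → ℝ) :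
    y ⬝ᵥ (adjMat G).mulVec z = z ⬝ᵥ (adjMat G).mulVec y := by
  have : (adjMat G)ᵀ = adjMat G := by ext v w; exact adjMat_symm G w v
  rw [Matrix.dotProduct_mulVec, ← Matrix.mulVec_transpose, this, dotProduct_comm]

theorem adj_bound {V : Type*} [Fintype V] (H : SimpleGraph V) (a : ℕ) (hH : IsRegularGraph H a)
    (y z : V → ℝ) (s t : ℝ) (hst : ∀ p q : ℝ, - (p * q) ≤ s * p ^ 2 + t * q ^ 2) :
    - (a * s * (y ⬝ᵥ y) + a * t * (z ⬝ᵥ z)) ≤ y ⬝ᵥ (adjMat H).mulVec z := by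
  classical
  have h1 : ∀ w, ∑ v, adjMat H v w = a := by
    intro w
    simp_rw [fun v => adjMat_symm H v w]
    rw [sum_adjMat, hH w]
  have h2 : ∀ w, ∑ v, adjMat H w v = a := by
    intro w
    rw [sum_adjMat, hH w]
  have e1 : a * s * (y ⬝ᵥ y) = ∑ v, ∑ w, adjMat H v w * (s * y v ^ 2) := by
    simp_rw [← Finset.sum_mul, h2, dotProduct, Finset.mul_sum]
    apply Finset.sum_congr rfl; intros; ring
  have e2 : a * t * (z ⬝ᵥ z) = ∑ v, ∑ w, adjMat H v w * (t * z w ^ 2) := by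
    rw [Finset.sum_comm]
    simp_rw [← Finset.sum_mul, h1, dotProduct, Finset.mul_sum]
    apply Finset.sum_congr rfl; intros; ring
  have e3 : y ⬝ᵥ (adjMat H).mulVec z = ∑ v, ∑ w, adjMat H v w * (y v * z w) := by
    simp only [dotProduct, mulVec, Finset.mul_sum]
    apply Finset.sum_congr rfl; intros
    apply Finset.sum_congr rfl; intros; ring
  rw [e1, e2, e3, ← Finset.sum_add_distrib, ← Finset.sum_neg_distrib]
  apply Finset.sum_le_sum; intro v _
  rw [← Finset.sum_add_distrib, ← Finset.sum_neg_distrib]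
  apply Finset.sum_le_sum; intro w _
  have : 0 ≤ adjMat H v w := by rw [adjMat_apply]; split_ifs <;> norm_num
  nlinarith [mul_le_mul_of_nonneg_left (hst (y v) (z w)) this]

theorem adj_one {V : Type*} [Fintype V] (H : SimpleGraph V) (a : ℕ) (hH : IsRegularGraph H a) :
    (adjMat H).mulVec (fun _ => (1:ℝ)) = (a : ℝ) • (fun _ => (1:ℝ)) := by
  funext v
  simp only [mulVec, dotProduct, mul_one, Pi.smul_apply, smul_eq_mul]
  rw [sum_adjMat, hH v]

theorem sum_subtype_ite {n : ℕ} {M : Type*} [AddCommMonoid M] (P : Fin n → Prop)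
    [DecidablePred P] [Fintype {i // P i}] (f : Fin n → M) :
    ∑ i : {i // P i}, f i = ∑ i, if P i then f i else 0 := by
  rw [← Finset.sum_filter]
  exact (Finset.sum_subtype (Finset.univ.filter P) (by simp) f).symm

set_option maxHeartbeats 2000000 in
/-- the orthonormal eigenbasis of `A_G` is given by the family `b` with
eigenvalues `μ`; every eigenvector with eigenvalue exceeding `2√(d-1)` has all entries at
most `√(m/n)` in absolute value, and at most `m` of the eigenvalues exceed `2√(d-1)`. -/
theorem stmt_8 (d n m : ℕ) (hd : 22000 ≤ d) (a : ℕ) (ha : a = ⌈12 * Real.sqrt d⌉₊)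
    (G : SimpleGraph (Fin n)) (hbip : Bipartite G) (hreg : IsRegularGraph G d)
    (hlam2 : lam (adjMat G) 2 ≤ (d : ℝ) - 2 * a)
    (b : Fin n → (Fin n → ℝ)) (μ : Fin n → ℝ)
    (heig : ∀ i, (adjMat G).mulVec (b i) = μ i • b i)
    (horth : ∀ i j, b i ⬝ᵥ b j = if i = j then (1 : ℝ) else 0)
    (hcount : (Finset.univ.filter fun i => 2 * Real.sqrt ((d : ℝ) - 1) < μ i).card ≤ m)
    (hentry : ∀ i, 2 * Real.sqrt ((d : ℝ) - 1) < μ i → ∀ x, |b i x| ≤ Real.sqrt ((m : ℝ) / n))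
    (hm : 2 * Real.logb 2 d ≤ (m : ℝ)) (hn : m ^ 9 < n) :
    ∃ H : SimpleGraph (Fin n), H ≤ G ∧ IsRegularGraph H a ∧
      lam (adjMat G - (2 : ℝ) • adjMat H) 1 = (d : ℝ) - 2 * a := by
  classical
  have hn0 : 0 < n := by omega
  have hnR : (0:ℝ) < n := by exact_mod_cast hn0
  have hdR : (22000:ℝ) ≤ d := by exact_mod_cast hd
  set ρ := Real.sqrt d with hρ
  have hρ2 : ρ ^ 2 = d := Real.sq_sqrt (by positivity)
  have hρ0 : 0 ≤ ρ := Real.sqrt_nonneg _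
  have hρ1 : (148:ℝ) ≤ ρ := by
    apply Real.le_sqrt_of_sq_le; norm_num; linarith
  have ha1 : 12 * ρ ≤ a := by rw [ha]; exact Nat.le_ceil _
  have ha2 : (a:ℝ) < 12 * ρ + 1 := by rw [ha]; exact Nat.ceil_lt_add_one (by positivity)
  have hκ : Real.sqrt ((d:ℝ) - 1) ≤ ρ := Real.sqrt_le_sqrt (by linarith)
  set κ := 2 * Real.sqrt ((d : ℝ) - 1) with hκd
  set r : ℝ := (d:ℝ) - 2 * a with hr
  have had' : (a:ℝ) ≤ 0.082 * d := by nlinarith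
  have had : a ≤ d := by
    have : (a:ℝ) ≤ d := by linarith
    exact_mod_cast this
  have hrd : r < d := by rw [hr]; linarith
  let P : Fin n → Prop := fun i => κ < μ i ∧ μ i ≤ r
  obtain ⟨H, hHG, hHreg, hHq⟩ := factor_exists G hbip d a (by omega) had hreg
    (fun i : {i // P i} => b i)
  have hcardP : (Finset.univ.filter P).card ≤ m := by
    refine le_trans (Finset.card_le_card ?_) hcount
    intro i hi
    simp only [Finset.mem_filter, Finset.mem_univ, true_and] at hi ⊢
    exact hi.1
  have hk : Fintype.card {i // P i} ≤ m := by
    rw [Fintype.card_subtype]; exact hcardP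
  refine ⟨H, hHG, hHreg, ?_⟩
  set one : Fin n → ℝ := fun _ => 1 with hone
  have hG1 := adj_one G d hreg
  have hH1 := adj_one H a hHreg
  have hM1 : (adjMat G - (2:ℝ) • adjMat H).mulVec one = r • one := by
    rw [Matrix.sub_mulVec, smul_mulVec, hG1, hH1, hr, sub_smul, mul_smul]
  have hone0 : one ≠ 0 := by
    intro h
    have := congrFun h ⟨0, hn0⟩
    simp [hone] at this
  apply lam_one
  · exact ⟨one, hone0, hM1⟩
  intro s v hv hMv
  by_contra hs
  push Not at hs
  have hv1 : one ⬝ᵥ v = 0 := by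
    have h1 : one ⬝ᵥ (adjMat G - (2:ℝ) • adjMat H).mulVec v
        = v ⬝ᵥ (adjMat G - (2:ℝ) • adjMat H).mulVec one := by
      simp only [Matrix.sub_mulVec, smul_mulVec, dotProduct_sub, dotProduct_smul]
      rw [adj_dot_symm G one v, adj_dot_symm H one v]
    rw [hMv, hM1, dotProduct_smul, dotProduct_smul, dotProduct_comm v one, smul_eq_mul,
      smul_eq_mul] at h1
    have h2 : (s - r) * (one ⬝ᵥ v) = 0 := by linarith
    rcases mul_eq_zero.mp h2 with h | h
    · linarith
    · exact h
  have hbig : ∀ i, r < μ i → b i ⬝ᵥ v = 0 := by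
    intro i hi
    have hj : ∀ j, j ≠ i → b j ⬝ᵥ one = 0 := by
      intro j hji
      by_contra hne
      apply hji
      apply lam_two (adjMat G) b μ heig horth r hlam2 j i _ hi
      have h1 := adj_dot_symm G (b j) one
      rw [hG1, heig j, dotProduct_smul, dotProduct_smul, dotProduct_comm one, smul_eq_mul,
        smul_eq_mul] at h1
      have := mul_right_cancel₀ hne h1
      linarith
    have h1 := expand b horth one
    rw [Finset.sum_eq_single i (by intro j _ hji; rw [hj j hji, zero_smul]) (by simp)] at h1
    have h2 := hv1
    rw [h1, smul_dotProduct, smul_eq_mul] at h2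
    rcases mul_eq_zero.mp h2 with h | h
    · rw [h, zero_smul] at h1
      exact absurd h1 hone0
    · exact h
  let c : Fin n → ℝ := fun i => b i ⬝ᵥ v
  let α : Fin n → ℝ := fun i => if P i then c i else 0
  let β : Fin n → ℝ := fun i => if P i then 0 else c i
  set u : Fin n → ℝ := ∑ i, α i • b i with hu
  set w : Fin n → ℝ := ∑ i, β i • b i with hw
  have hvuw : v = u + w := by
    rw [hu, hw, ← Finset.sum_add_distrib]
    conv_lhs => rw [expand b horth v]
    apply Finset.sum_congr rfl
    intro i _
    rw [← add_smul]
    congr 1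
    simp only [α, β, c]
    split_ifs <;> simp
  have hGs : ∀ γ : Fin n → ℝ, (adjMat G).mulVec (∑ i, γ i • b i) = ∑ i, (γ i * μ i) • b i := by
    intro γ
    rw [Matrix.mulVec_sum]
    apply Finset.sum_congr rfl
    intro i _
    rw [Matrix.mulVec_smul, heig, smul_smul]
  have hUU : u ⬝ᵥ u = ∑ i, α i * α i := sum_dot b horth α α
  have hWW : w ⬝ᵥ w = ∑ i, β i * β i := sum_dot b horth β β
  have hUW : u ⬝ᵥ w = 0 := by
    rw [hu, hw, sum_dot b horth α β]
    apply Finset.sum_eq_zero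
    intro i _
    simp only [α, β]
    split_ifs <;> simp
  have hUGW : u ⬝ᵥ (adjMat G).mulVec w = 0 := by
    rw [hu, hw, hGs, sum_dot b horth α]
    apply Finset.sum_eq_zero
    intro i _
    simp only [α, β]
    split_ifs <;> simp
  have hUGU : u ⬝ᵥ (adjMat G).mulVec u ≤ r * (u ⬝ᵥ u) := by
    rw [hUU, hu, hGs, sum_dot b horth α, Finset.mul_sum]
    apply Finset.sum_le_sum
    intro i _
    simp only [α]
    split_ifs with h
    · nlinarith [mul_le_mul_of_nonneg_left h.2 (mul_self_nonneg (c i))]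
    · simp
  have hWGW : w ⬝ᵥ (adjMat G).mulVec w ≤ κ * (w ⬝ᵥ w) := by
    rw [hWW, hw, hGs, sum_dot b horth β, Finset.mul_sum]
    apply Finset.sum_le_sum
    intro i _
    simp only [β]
    split_ifs with h
    · simp
    · by_cases hi : r < μ i
      · have : c i = 0 := hbig i hi
        simp [this]
      · have : μ i ≤ κ := by
          by_contra h'
          exact h ⟨not_le.mp h', not_lt.mp hi⟩
        nlinarith [mul_le_mul_of_nonneg_left this (mul_self_nonneg (c i))]
  have hUnn : 0 ≤ u ⬝ᵥ u := by rw [hUU]; exact Finset.sum_nonneg fun i _ => mul_self_nonneg _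
  have hWnn : 0 ≤ w ⬝ᵥ w := by rw [hWW]; exact Finset.sum_nonneg fun i _ => mul_self_nonneg _
  have hpt : ∀ x, u x ^ 2 ≤ (u ⬝ᵥ u) * (m * ((m:ℝ) / n)) := by
    intro x
    have h1 : u x = ∑ i, α i * (if P i then b i x else 0) := by
      rw [hu]
      simp only [Finset.sum_apply, Pi.smul_apply, smul_eq_mul]
      apply Finset.sum_congr rfl
      intro i _
      simp only [α]
      split_ifs <;> simp
    rw [h1]
    refine (Finset.sum_mul_sq_le_sq_mul_sq _ _ _).trans ?_
    have h2 : ∑ i, α i ^ 2 = u ⬝ᵥ u := by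
      rw [hUU]; exact Finset.sum_congr rfl fun i _ => sq _
    rw [h2]
    apply mul_le_mul_of_nonneg_left _ hUnn
    have h3 : ∑ i, (if P i then b i x else 0) ^ 2
        ≤ ∑ i, (if P i then ((m:ℝ) / n) else 0) := by
      apply Finset.sum_le_sum
      intro i _
      split_ifs with h
      · have h4 := hentry i h.1 x
        have h5 := Real.sq_sqrt (show (0:ℝ) ≤ (m:ℝ) / n by positivity)
        rw [← h5, ← sq_abs (b i x)]
        exact pow_le_pow_left₀ (abs_nonneg _) h4 2
      · simp
    refine h3.trans ?_
    rw [← Finset.sum_filter, Finset.sum_const, nsmul_eq_mul]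
    apply mul_le_mul_of_nonneg_right _ (by positivity)
    exact_mod_cast hcardP
  have hUHU : (a / d : ℝ) * (u ⬝ᵥ (adjMat G).mulVec u) - 4 * (u ⬝ᵥ u)
      ≤ u ⬝ᵥ (adjMat H).mulVec u := by
    have h1 := hHq (fun i => c i) u ((u ⬝ᵥ u) * (m * ((m:ℝ) / n))) (by
      rw [hu]
      rw [sum_subtype_ite P (fun i => c i • b i)]
      apply Finset.sum_congr rfl
      intro i _
      simp only [α]
      split_ifs <;> simp) hpt (by positivity)
    have h2 : ∑ x, u x ^ 2 = u ⬝ᵥ u := Finset.sum_congr rfl fun i _ => sq _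
    rw [h2] at h1
    have h3 : ((Fintype.card {i // P i} ^ 2 : ℕ) : ℝ) * ((u ⬝ᵥ u) * (m * ((m:ℝ) / n)))
        ≤ u ⬝ᵥ u := by
      have h4 : ((Fintype.card {i // P i} ^ 2 : ℕ) : ℝ) ≤ (m:ℝ) ^ 2 := by
        exact_mod_cast Nat.pow_le_pow_left hk 2
      have h5 : (m:ℝ) ^ 2 * (m * ((m:ℝ) / n)) ≤ 1 := by
        have : m ^ 4 ≤ n := by
          rcases Nat.eq_zero_or_pos m with h | h
          · subst h; simp
          · exact (Nat.pow_le_pow_right h (by norm_num : 4 ≤ 9)).trans hn.le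
        have h6 : (m:ℝ) ^ 4 ≤ n := by exact_mod_cast this
        have h7 : (m:ℝ) ^ 2 * (m * ((m:ℝ) / n)) = (m:ℝ) ^ 4 / n := by ring
        rw [h7, div_le_one hnR]
        exact h6
      calc _ ≤ (m:ℝ) ^ 2 * ((u ⬝ᵥ u) * (m * ((m:ℝ) / n))) :=
            mul_le_mul_of_nonneg_right h4 (by positivity)
        _ = (u ⬝ᵥ u) * ((m:ℝ) ^ 2 * (m * ((m:ℝ) / n))) := by ring
        _ ≤ (u ⬝ᵥ u) * 1 := mul_le_mul_of_nonneg_left h5 hUnn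
        _ = _ := mul_one _
    linarith
  have hUHW := adj_bound H a hHreg u w (3 / 8) (2 / 3)
    (by intro p q; nlinarith [sq_nonneg (p + 4 / 3 * q)])
  have hWHW := adj_bound H a hHreg w w (1 / 2) (1 / 2)
    (by intro p q; nlinarith [sq_nonneg (p + q)])
  have hVV : v ⬝ᵥ v = u ⬝ᵥ u + w ⬝ᵥ w := by
    rw [hvuw]
    simp only [add_dotProduct, dotProduct_add, hUW, dotProduct_comm w u]
    ring
  have hVpos : 0 < v ⬝ᵥ v := by
    have h1 : v ⬝ᵥ v ≠ 0 := by rwa [Ne, dotProduct_self_eq_zero]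
    exact lt_of_le_of_ne (by rw [hVV]; linarith) (Ne.symm h1)
  have hmain : s * (v ⬝ᵥ v) = u ⬝ᵥ (adjMat G).mulVec u + w ⬝ᵥ (adjMat G).mulVec w
      - 2 * (u ⬝ᵥ (adjMat H).mulVec u) - 4 * (u ⬝ᵥ (adjMat H).mulVec w)
      - 2 * (w ⬝ᵥ (adjMat H).mulVec w) := by
    have h1 : v ⬝ᵥ (adjMat G - (2:ℝ) • adjMat H).mulVec v = s * (v ⬝ᵥ v) := by
      rw [hMv, dotProduct_smul, smul_eq_mul]
    rw [← h1]
    rw [hvuw]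
    simp only [Matrix.sub_mulVec, smul_mulVec, dotProduct_sub, dotProduct_smul,
      Matrix.mulVec_add, add_dotProduct, dotProduct_add, smul_eq_mul]
    rw [adj_dot_symm G w u, adj_dot_symm H w u, hUGW]
    ring
  have hd0 : (0:ℝ) < d := by linarith
  have hp1 : (a / d : ℝ) ≤ 0.082 := by rw [div_le_iff₀ hd0]; exact had'
  have hp2 : (a / d : ℝ) * r = a * (1 - 2 * (a / d : ℝ)) := by
    rw [hr]; field_simp
  have hp3 : 1.672 * a ≤ 2 * ((a / d : ℝ) * r) := by
    rw [hp2]; nlinarith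
  have q1 : (1 - 2 * (a / d : ℝ)) * (u ⬝ᵥ (adjMat G).mulVec u)
      ≤ (1 - 2 * (a / d : ℝ)) * (r * (u ⬝ᵥ u)) :=
    mul_le_mul_of_nonneg_left hUGU (by linarith)
  have q2 : 0 ≤ (2 * ((a / d : ℝ) * r) - 8 - 3 / 2 * a) * (u ⬝ᵥ u) :=
    mul_nonneg (by linarith) hUnn
  have q3 : 0 ≤ (r - κ - 14 / 3 * a) * (w ⬝ᵥ w) := by
    apply mul_nonneg _ hWnn
    rw [hr]
    nlinarith
  have q4 : 0 < (s - r) * (v ⬝ᵥ v) := mul_pos (by linarith) hVpos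
  rw [sub_mul, hmain, hVV] at q4
  linarith
end
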